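/- Let p > 3 be a prime with p ≡ 3 (mod 4). Then the Bernoulli number B_{(p+1)/2} is p-integral and B_{(p+1)/2} ≡ -(1/2)·h(-p) (mod p), where h(-p) is the class number of ℚ(√-p); in particular B_{(p+1)/2} ≢ 0 (mod p). -/

import Mathlib

open Finset in
theorem sum_choose_mul_bernoulli_mul_two_pow (n : ℕ) :
    ∑ i ∈ range (n + 1), (n.choose i : ℚ) * bernoulli i * 2 ^ i = (2 - 2 ^ n) * bernoulli n := by
  have key : PowerSeries.rescale (2 : ℚ) (bernoulliPowerSeries ℚ) * PowerSeries.exp ℚ =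
      2 * bernoulliPowerSeries ℚ - PowerSeries.rescale (2 : ℚ) (bernoulliPowerSeries ℚ) := by
    have h1 := bernoulliPowerSeries_mul_exp_sub_one ℚ
    have hne : PowerSeries.exp ℚ - 1 ≠ 0 := by
      intro h
      rw [h, mul_zero] at h1
      exact PowerSeries.X_ne_zero h1.symm
    have h2 := congrArg (PowerSeries.rescale (2 : ℚ)) h1
    have h3 : PowerSeries.rescale (2 : ℚ) (PowerSeries.exp ℚ) = PowerSeries.exp ℚ ^ 2 := by
      rw [PowerSeries.exp_pow_eq_rescale_exp]; norm_num
    have h4 : PowerSeries.rescale (2 : ℚ) (PowerSeries.X : PowerSeries ℚ) =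
        2 * PowerSeries.X := by
      rw [PowerSeries.rescale_X, map_ofNat]
    rw [map_mul, map_sub, map_one, h3, h4] at h2
    apply mul_right_cancel₀ hne
    linear_combination h2 - 2 * h1
  have h := congrArg (PowerSeries.coeff n) key
  rw [PowerSeries.coeff_mul, Finset.Nat.sum_antidiagonal_eq_sum_range_succ_mk] at h
  have h2 : (2 : PowerSeries ℚ) = PowerSeries.C (2 : ℚ) := (map_ofNat _ 2).symm
  rw [map_sub, h2, PowerSeries.coeff_C_mul] at h
  simp only [PowerSeries.coeff_rescale, bernoulliPowerSeries, PowerSeries.coeff_mk,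
    PowerSeries.coeff_exp, Algebra.algebraMap_self, RingHom.id_apply] at h
  have hfac : (n.factorial : ℚ) ≠ 0 := by positivity
  have h5 := congrArg (· * (n.factorial : ℚ)) h
  simp only [Finset.sum_mul] at h5
  have : (2 - 2 ^ n) * bernoulli n =
      (2 * (bernoulli n / n.factorial) - 2 ^ n * (bernoulli n / n.factorial)) * n.factorial := by
    field_simp
  rw [this, ← h5]
  refine Finset.sum_congr rfl fun i hi => ?_
  have hi' : i ≤ n := by simpa [Nat.lt_succ_iff] using hi
  rw [Nat.cast_choose ℚ hi']
  field_simp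

theorem exists_padicInt_eq_bernoulli (p : ℕ) [Fact p.Prime] (n : ℕ) (hn : n + 1 < p) :
    ∃ b : ℤ_[p], (b : ℚ_[p]) = (bernoulli n : ℚ) := by
  induction n using Nat.strong_induction_on with
  | _ n ih =>
    have hs := sum_bernoulli (n + 1)
    rw [Finset.sum_range_succ] at hs
    have hs' := congrArg (fun x : ℚ => (x : ℚ_[p])) hs
    simp only [Nat.choose_succ_self_right] at hs'
    push_cast at hs'
    have hu : IsUnit ((n + 1 : ℕ) : ℤ_[p]) := by
      rw [PadicInt.isUnit_iff]
      have := (PadicInt.norm_natCast_lt_one_iff (p := p) (n := n + 1)).not.2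
        (Nat.not_dvd_of_pos_of_lt (by omega) hn)
      exact le_antisymm (PadicInt.norm_le_one _) (not_lt.1 this)
    obtain ⟨u, hu⟩ := hu.exists_left_inv
    choose! b hb using fun k (hk : k < n) => ih k hk (by omega)
    refine ⟨u * ((if n = 0 then 1 else 0) -
      ∑ k ∈ Finset.range n, ((n + 1).choose k : ℤ_[p]) * b k), ?_⟩
    have hu' := congrArg (fun x : ℤ_[p] => (x : ℚ_[p])) hu
    push_cast at hu'
    have hsum : ∑ k ∈ Finset.range n, ((n + 1).choose k : ℚ_[p]) * (b k : ℚ_[p]) =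
        ∑ k ∈ Finset.range n, ((n + 1).choose k : ℚ_[p]) * ((bernoulli k : ℚ) : ℚ_[p]) := by
      refine Finset.sum_congr rfl fun k hk => ?_
      rw [hb k (Finset.mem_range.1 hk)]
    have hc : (((∑ k ∈ Finset.range n, ((n + 1).choose k : ℤ_[p]) * b k : ℤ_[p])) : ℚ_[p]) =
        ∑ k ∈ Finset.range n, ((n + 1).choose k : ℚ_[p]) * (b k : ℚ_[p]) := by
      rw [PadicInt.coe_sum]; push_cast; rfl
    have hite : (((if n = 0 then 1 else 0 : ℤ_[p])) : ℚ_[p]) = if n = 0 then 1 else 0 := by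
      split_ifs <;> simp
    rw [PadicInt.coe_mul, PadicInt.coe_sub, hite, hc, hsum]
    have : ((if n + 1 = 1 then 1 else 0 : ℚ) : ℚ_[p]) = if n = 0 then 1 else 0 := by
      split_ifs <;> simp_all
    simp only [add_eq_right] at hs' this
    rw [this] at hs'
    linear_combination ((bernoulli n : ℚ) : ℚ_[p]) * hu' - (u : ℚ_[p]) * hs'

open Finset in
theorem sum_range_pow_eq_toZMod_bernoulli (p : ℕ) [Fact p.Prime] (m : ℕ) (hm : p = 2 * m + 1)
    (hm2 : 2 ≤ m) (b : ℤ_[p]) (hb : (b : ℚ_[p]) = (bernoulli (m + 1) : ℚ)) :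
    2 ^ m * ∑ a ∈ range (m + 1), (a : ZMod p) ^ m = (2 - 4 * 2 ^ m) * PadicInt.toZMod b := by
  choose! c hc using fun k (hk : k < m + 2) => exists_padicInt_eq_bernoulli p k (by omega)
  have hbc : b = c (m + 1) := by
    apply PadicInt.ext
    rw [hb, hc _ (by omega)]
  have e1 : ((m + 1 : ℕ) : ℤ_[p]) * ∑ a ∈ range (m + 1), (a : ℤ_[p]) ^ m =
      ∑ i ∈ range (m + 1),
        c i * ((m + 1).choose i : ℤ_[p]) * ((m + 1 : ℕ) : ℤ_[p]) ^ (m + 1 - i) := by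
    apply PadicInt.ext
    have h := congrArg (fun x : ℚ => ((m + 1 : ℚ) * x : ℚ)) (sum_range_pow (m + 1) m)
    rw [← sum_div, mul_div_cancel₀ _ (by positivity)] at h
    have h := congrArg (fun x : ℚ => (x : ℚ_[p])) h
    push_cast at h
    push_cast [PadicInt.coe_sum]
    rw [h]
    exact sum_congr rfl fun i hi => by rw [hc i (by have := mem_range.1 hi; omega)]
  have e2 : ∑ i ∈ range (m + 1 + 1), ((m + 1).choose i : ℤ_[p]) * c i * 2 ^ i =
      (2 - 2 ^ (m + 1)) * c (m + 1) := by
    apply PadicInt.ext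
    have h := congrArg (fun x : ℚ => (x : ℚ_[p])) (sum_choose_mul_bernoulli_mul_two_pow (m + 1))
    have h2 : ((2 : ℤ_[p]) : ℚ_[p]) = 2 := rfl
    push_cast at h
    push_cast [PadicInt.coe_sum, h2]
    rw [hc _ (by omega : m + 1 < m + 2), ← h]
    exact sum_congr rfl fun i hi => by rw [hc i (by have := mem_range.1 hi; omega)]
  have f1 := congrArg PadicInt.toZMod e1
  have f2 := congrArg PadicInt.toZMod e2
  rw [sum_range_succ] at f2
  simp only [map_mul, map_sum, map_pow, map_natCast, map_add, map_sub, map_ofNat,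
    Nat.choose_self] at f1 f2
  have h2 : (2 : ZMod p) * ((m + 1 : ℕ) : ZMod p) = 1 := by
    have : ((2 * m + 1 : ℕ) : ZMod p) = 0 := by rw [← hm]; simp
    push_cast at this ⊢
    linear_combination this
  have f3 : 2 ^ (m + 1) * ∑ i ∈ range (m + 1), PadicInt.toZMod (c i) * ((m + 1).choose i : ZMod p) *
      ((m + 1 : ℕ) : ZMod p) ^ (m + 1 - i) =
      ∑ i ∈ range (m + 1), ((m + 1).choose i : ZMod p) * PadicInt.toZMod (c i) * 2 ^ i := by
    rw [mul_sum]
    refine sum_congr rfl fun i hi => ?_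
    have hi' : i ≤ m + 1 := (mem_range.1 hi).le
    have : (2 : ZMod p) ^ (m + 1) = 2 ^ i * 2 ^ (m + 1 - i) := by
      rw [← pow_add]; congr 1; omega
    have h3 : (2 : ZMod p) ^ (m + 1 - i) * ((m + 1 : ℕ) : ZMod p) ^ (m + 1 - i) = 1 := by
      rw [← mul_pow, h2, one_pow]
    rw [this]
    linear_combination (2 ^ i * PadicInt.toZMod (c i) * ((m + 1).choose i : ZMod p)) * h3
  rw [← f1] at f3
  rw [hbc]
  push_cast at *
  linear_combination f3 + f2 - 2 ^ m * (∑ a ∈ range (m + 1), (a : ZMod p) ^ m) * h2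

theorem bernoulli_two_mul_add_half_ne_zero (k : ℕ) (hk : 0 < k) (h : ℕ) :
    bernoulli (2 * k) + 1 / 2 * (h : ℚ) ≠ 0 := by
  intro h0
  obtain ⟨z, hz⟩ := Bernoulli.vonStaudt_clausen k
  have h3 : 3 ∈ (Finset.range (2 * k + 2)).filter (fun p => p.Prime ∧ (p - 1) ∣ 2 * k) := by
    rw [Finset.mem_filter, Finset.mem_range]
    exact ⟨by omega, by norm_num, by norm_num⟩
  have : Fact (Nat.Prime 3) := ⟨by norm_num⟩
  rw [← Finset.add_sum_erase _ _ h3] at hz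
  set T := ∑ x ∈ ((Finset.range (2 * k + 2)).filter
    (fun p => p.Prime ∧ (p - 1) ∣ 2 * k)).erase 3, (1 : ℚ) / x with hT
  have hTn : ‖(T : ℚ_[3])‖ ≤ 1 := by
    rw [hT]
    push_cast
    refine IsUltrametricDist.norm_sum_le_of_forall_le_of_nonneg zero_le_one fun q hq => ?_
    rw [Finset.mem_erase, Finset.mem_filter] at hq
    have : ‖(q : ℚ_[3])‖ = 1 := by
      rw [Padic.norm_natCast_eq_one_iff]
      exact (Nat.coprime_primes (by norm_num) hq.2.2.1).2 (Ne.symm hq.1)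
    simp [this]
  have h2 : ‖(2 : ℚ_[3])‖ = 1 := by
    have := (Padic.norm_natCast_eq_one_iff (p := 3) (n := 2)).2 (by norm_num)
    simpa using this
  have e : (1 / 3 : ℚ) = z + 1 / 2 * h - T := by push_cast at hz; linarith
  have e' : ((1 / 3 : ℚ) : ℚ_[3]) = (z : ℚ_[3]) + 1 / 2 * (h : ℚ_[3]) - (T : ℚ_[3]) := by
    rw [e]; push_cast; ring
  have n1 : ‖((1 / 3 : ℚ) : ℚ_[3])‖ = 3 := by
    have := Padic.norm_p (p := 3)
    push_cast at this ⊢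
    rw [norm_div, this]; simp
  have n2 : ‖(z : ℚ_[3]) + 1 / 2 * (h : ℚ_[3]) - (T : ℚ_[3])‖ ≤ 1 := by
    rw [sub_eq_add_neg]
    refine (IsUltrametricDist.norm_add_le_max _ _).trans (max_le ?_ (by rwa [norm_neg]))
    refine (IsUltrametricDist.norm_add_le_max _ _).trans (max_le (Padic.norm_int_le_one z) ?_)
    rw [norm_mul, norm_div, h2]
    simpa using Padic.norm_int_le_one (p := 3) (h : ℤ)
  rw [← e', n1] at n2
  norm_num at n2

theorem bernoulli_congruence_of_class_number_formula (p : ℕ) [Fact p.Prime] (hp3 : 3 < p)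
    (hp4 : p % 4 = 3) (h : ℕ) (hpos : 0 < h) (hlt : h < p)
    (hS : (2 - legendreSym p 2) * h = ∑ a ∈ Finset.range ((p + 1) / 2), legendreSym p a) :
    0 ≤ padicValRat p (bernoulli ((p + 1) / 2)) ∧
      1 ≤ padicValRat p (bernoulli ((p + 1) / 2) + (1 / 2) * (h : ℚ)) ∧
      ¬ 1 ≤ padicValRat p (bernoulli ((p + 1) / 2)) := by
  have hp : p.Prime := Fact.out
  obtain ⟨m, hm⟩ : ∃ m, p = 2 * m + 1 := ⟨p / 2, by omega⟩
  have hm1 : (p + 1) / 2 = m + 1 := by omega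
  have hm2 : p / 2 = m := by omega
  rw [hm1] at hS ⊢
  obtain ⟨b, hb⟩ := exists_padicInt_eq_bernoulli p (m + 1) (by omega)
  have key := sum_range_pow_eq_toZMod_bernoulli p m hm (by omega) b hb
  have hS' := congrArg (fun x : ℤ => (x : ZMod p)) hS
  push_cast at hS'
  simp only [legendreSym.eq_pow, hm2] at hS'
  push_cast at hS'
  rw [← hS'] at key
  have two_ne : (2 : ZMod p) ≠ 0 := by
    have := (ZMod.natCast_eq_zero_iff 2 p).not.2 (Nat.not_dvd_of_pos_of_lt (by norm_num) (by omega))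
    exact_mod_cast this
  have three_ne : (3 : ZMod p) ≠ 0 := by
    have := (ZMod.natCast_eq_zero_iff 3 p).not.2 (Nat.not_dvd_of_pos_of_lt (by norm_num) (by omega))
    exact_mod_cast this
  have hb2 : 2 * PadicInt.toZMod b + (h : ZMod p) = 0 := by
    have := ZMod.pow_div_two_eq_neg_one_or_one p two_ne
    rw [hm2] at this
    rcases this with h1 | h1 <;> rw [h1] at key
    · linear_combination key
    · apply (mul_eq_zero_iff_left three_ne).1
      linear_combination -key
  have h_ne : (h : ZMod p) ≠ 0 := (ZMod.natCast_eq_zero_iff h p).not.2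
      (Nat.not_dvd_of_pos_of_lt hpos hlt)
  have hb_ne : PadicInt.toZMod b ≠ 0 := by
    intro h0
    rw [h0] at hb2
    exact h_ne (by simpa using hb2)
  have norm_b : ‖b‖ = 1 := by
    rw [← PadicInt.isUnit_iff]
    by_contra hu
    apply hb_ne
    rw [← RingHom.mem_ker, PadicInt.ker_toZMod]
    exact (IsLocalRing.mem_maximalIdeal _).2 hu
  have hB0 : bernoulli (m + 1) ≠ 0 := by
    intro h0
    rw [h0, Rat.cast_zero] at hb
    have := PadicInt.norm_def (z := b)
    rw [hb, norm_b] at this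
    simp at this
  have v0 : padicValRat p (bernoulli (m + 1)) = 0 := by
    have h1 : ‖((bernoulli (m + 1) : ℚ) : ℚ_[p])‖ = 1 := by rw [← hb]; exact norm_b
    rw [Padic.eq_padicNorm, padicNorm.eq_zpow_of_nonzero hB0] at h1
    push_cast at h1
    rw [zpow_eq_one_iff_right₀ (by positivity) (by exact_mod_cast hp.one_lt.ne')] at h1
    omega
  refine ⟨v0.ge, ?_, by omega⟩
  have hne : bernoulli (m + 1) + 1 / 2 * (h : ℚ) ≠ 0 := by
    obtain ⟨k, hk⟩ : ∃ k, m + 1 = 2 * k := ⟨(m + 1) / 2, by omega⟩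
    rw [hk]
    exact bernoulli_two_mul_add_half_ne_zero k (by omega) h
  have hn : ‖(2 * b + h : ℤ_[p])‖ < 1 := by
    rw [← PadicInt.mem_nonunits, ← IsLocalRing.mem_maximalIdeal, ← PadicInt.ker_toZMod,
      RingHom.mem_ker]
    simpa only [map_add, map_mul, map_natCast, map_ofNat] using hb2
  have h1 : ‖((bernoulli (m + 1) + 1 / 2 * (h : ℚ) : ℚ) : ℚ_[p])‖ < 1 := by
    have e : ((bernoulli (m + 1) + 1 / 2 * (h : ℚ) : ℚ) : ℚ_[p]) =
        (2 * b + h : ℤ_[p]) / (2 : ℚ_[p]) := by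
      have h2 : ((2 : ℤ_[p]) : ℚ_[p]) = 2 := rfl
      push_cast [h2, ← hb]
      ring
    have h2 : ‖(2 : ℚ_[p])‖ = 1 := by
      have := (Padic.norm_natCast_eq_one_iff (p := p) (n := 2)).2
        ((Nat.coprime_primes hp Nat.prime_two).2 (by omega))
      simpa using this
    rw [e, norm_div, h2, div_one]
    exact hn
  rw [Padic.eq_padicNorm, padicNorm.eq_zpow_of_nonzero hne] at h1
  push_cast at h1
  rw [zpow_lt_one_iff_right₀ (by exact_mod_cast hp.one_lt)] at h1
  omega

theorem ZMod.sum_eq_sum_range {M : Type*} [AddCommMonoid M] (n : ℕ) [NeZero n] (f : ZMod n → M) :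
    ∑ x, f x = ∑ a ∈ Finset.range n, f a := by
  symm
  refine Finset.sum_bij' (fun a _ => (a : ZMod n)) (fun x _ => x.val) ?_ ?_ ?_ ?_ ?_
  · simp
  · intro x _; simpa using ZMod.val_lt x
  · intro a ha; exact ZMod.val_cast_of_lt (Finset.mem_range.1 ha)
  · intro x _; simp
  · intro a _; rfl

theorem prod_two_mul_odd_mul_factorial (m : ℕ) :
    (∏ k ∈ Finset.range m, (4 * k + 2)) * m.factorial = (2 * m).factorial := by
  induction m with
  | zero => simp
  | succ m ih =>
    rw [Finset.prod_range_succ, show 2 * (m + 1) = 2 * m + 1 + 1 by ring, Nat.factorial_succ,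
      Nat.factorial_succ, Nat.factorial_succ, ← ih]
    ring

open Polynomial in
theorem FiniteField.sum_pow_mul_eval_eq_neg_coeff {F : Type*} [Field F] [Fintype F] (m : ℕ)
    (hm : 0 < m) (hcard : Fintype.card F = 2 * m + 1) (D : F[X]) (hD : D.natDegree = m) :
    ∑ x : F, x ^ m * D.eval x = -D.coeff m := by
  classical
  have hpow : ∑ x : F, x ^ (m + m) = -1 := by
    have h : ∀ x : F, x ^ (m + m) = if x = 0 then 0 else 1 := by
      intro x
      split_ifs with hx
      · rw [hx, zero_pow (by omega)]
      · have := FiniteField.pow_card_sub_one_eq_one x hx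
        rwa [hcard, show 2 * m + 1 - 1 = m + m by omega] at this
    simp only [h]
    have hc : ((2 * m + 1 : ℕ) : F) = 0 := by rw [← hcard]; exact Nat.cast_card_eq_zero F
    simp [Finset.sum_ite, Finset.filter_ne', Finset.card_erase_of_mem, hcard]
    push_cast at hc
    linear_combination hc
  simp only [Polynomial.eval_eq_sum_range, hD, Finset.mul_sum]
  have hcomm : ∀ (x : F) (i : ℕ), x ^ m * (D.coeff i * x ^ i) = D.coeff i * x ^ (m + i) :=
    fun x i => by ring
  simp only [hcomm]
  rw [Finset.sum_comm, Finset.sum_range_succ, Finset.sum_eq_zero]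
  · simp only [← Finset.mul_sum, hpow]
    ring
  · intro i hi
    rw [Finset.mem_range] at hi
    simp only [← Finset.mul_sum]
    rw [FiniteField.sum_pow_lt_card_sub_one F (m + i) (by omega), mul_zero]

open Polynomial in
/-- The sign in the product formula for the quadratic Gauss sum: compare the coefficients of
`(X - 1) ^ m` modulo `p`, where the cyclotomic polynomial is `(X - 1) ^ (2 * m)`. -/
theorem eq_one_of_cyclotomic_dvd_sub (p : ℕ) [Fact p.Prime] (m : ℕ) (hm : p = 2 * m + 1)
    (ε : ℤ) (hε : ε = 1 ∨ ε = -1)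
    (hdvd : cyclotomic p ℤ ∣ ∑ a ∈ Finset.range p, C (legendreSym p a) * X ^ a -
      C ε * ∏ k ∈ Finset.range m, (X ^ (2 * k + 1) - X ^ (p - (2 * k + 1)))) : ε = 1 := by
  have hp : p.Prime := Fact.out
  have hm0 : 0 < m := by have := hp.two_le; omega
  obtain ⟨Q, hQ⟩ := (Polynomial.map_dvd (Int.castRingHom (ZMod p)) hdvd)
  have hcyc : cyclotomic p (ZMod p) = (X - 1) ^ (p - 1) := by
    have := cyclotomic_mul_prime_eq_pow_of_not_dvd (ZMod p) (p := p) (n := 1)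
      (by simpa using hp.one_lt.ne')
    rwa [one_mul, cyclotomic_one] at this
  rw [map_cyclotomic, hcyc] at hQ
  have hQ' := congrArg (taylorAlgHom (1 : ZMod p)) hQ
  have hX1 : taylorAlgHom (1 : ZMod p) X = X + 1 := by rw [taylorAlgHom_apply, taylor_X, map_one]
  rw [map_mul, map_pow, map_sub, map_one, hX1, add_sub_cancel_right] at hQ'
  have h0 := congrArg (fun f => coeff f m) hQ'
  simp only [coeff_X_pow_mul', show ¬ (p - 1 ≤ m) by omega, if_false] at h0
  simp only [Polynomial.map_sub, Polynomial.map_mul, Polynomial.map_sum, Polynomial.map_prod,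
    Polynomial.map_pow, map_X, map_C, map_sub, map_mul, map_sum, map_prod, coeff_sub,
    finsetSum_coeff] at h0
  have hprod : (∏ k ∈ Finset.range m, (taylorAlgHom (1 : ZMod p) (X ^ (2 * k + 1)) -
      taylorAlgHom (1 : ZMod p) (X ^ (p - (2 * k + 1))))).coeff m =
      ∏ k ∈ Finset.range m, ((4 * k + 2 : ℕ) : ZMod p) := by
    have hX : ∀ k ∈ Finset.range m, ∃ g : (ZMod p)[X],
        taylorAlgHom (1 : ZMod p) (X ^ (2 * k + 1)) -
        taylorAlgHom (1 : ZMod p) (X ^ (p - (2 * k + 1))) = X * g ∧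
        g.coeff 0 = ((4 * k + 2 : ℕ) : ZMod p) := by
      intro k hk
      rw [Finset.mem_range] at hk
      have hd : X ∣ taylorAlgHom (1 : ZMod p) (X ^ (2 * k + 1)) -
        taylorAlgHom (1 : ZMod p) (X ^ (p - (2 * k + 1))) := by
        rw [X_dvd_iff]
        rw [coeff_sub, taylorAlgHom_apply, taylorAlgHom_apply, taylor_coeff_zero, taylor_coeff_zero]
        simp
      obtain ⟨g, hg⟩ := hd
      refine ⟨g, hg, ?_⟩
      have := congrArg (fun f => coeff f 1) hg
      simp only [coeff_X_mul, coeff_sub, taylorAlgHom_apply, taylor_coeff_one,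
        derivative_X_pow, eval_mul, eval_C, eval_pow, eval_X, one_pow, mul_one] at this
      rw [← this, Nat.cast_sub (by omega)]
      push_cast
      simp
      ring
    choose! g hg1 hg2 using hX
    rw [Finset.prod_congr rfl hg1, Finset.prod_mul_distrib, Finset.prod_const, Finset.card_range,
      coeff_X_pow_mul', if_pos le_rfl, Nat.sub_self, coeff_zero_prod,
      Finset.prod_congr rfl hg2]
  have hsum : ∀ a : ℕ, (taylorAlgHom (1 : ZMod p) (X ^ a)).coeff m = (a.choose m : ZMod p) := by
    intro a
    rw [taylorAlgHom_apply, taylor_coeff, ← monomial_one_right_eq_X_pow, hasseDeriv_monomial]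
    simp
  have hC : ∀ c : ZMod p, taylorAlgHom (1 : ZMod p) (C c) = C c := fun c => by
    rw [taylorAlgHom_apply, taylor_C]
  simp only [hC, coeff_C_mul, hprod, hsum, eq_intCast] at h0
  have h1 := congrArg (fun x => x * (m.factorial : ZMod p)) h0
  simp only [sub_mul, zero_mul, Finset.sum_mul] at h1
  have hw := ZMod.wilsons_lemma p
  rw [show p - 1 = 2 * m by omega, ← prod_two_mul_odd_mul_factorial] at hw
  have hL : ∑ i ∈ Finset.range p, (legendreSym p i : ZMod p) * (i.choose m : ZMod p) *
      (m.factorial : ZMod p) = -1 := by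
    have := FiniteField.sum_pow_mul_eval_eq_neg_coeff (F := ZMod p) m hm0
      (by rw [ZMod.card, hm]) (descPochhammer (ZMod p) m) (descPochhammer_natDegree _ _)
    rw [ZMod.sum_eq_sum_range] at this
    have hmon := monic_descPochhammer (ZMod p) m
    rw [Monic, leadingCoeff, descPochhammer_natDegree] at hmon
    rw [hmon] at this
    rw [← this]
    refine Finset.sum_congr rfl fun a _ => ?_
    rw [legendreSym.eq_pow, descPochhammer_eval_eq_descFactorial,
      Nat.descFactorial_eq_factorial_mul_choose, show p / 2 = m by omega]
    push_cast
    ring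
  rw [hL] at h1
  push_cast at hw h1
  have h2 : (ε : ZMod p) = 1 := by linear_combination h1 + ε * hw
  rcases hε with h | h
  · exact h
  · exfalso
    rw [h] at h2
    have h3 : ((2 : ℕ) : ZMod p) = 0 := by push_cast at h2 ⊢; linear_combination -h2
    rw [ZMod.natCast_eq_zero_iff] at h3
    have := Nat.le_of_dvd (by norm_num) h3
    omega

theorem sq_prod_odd_pow_sub (m : ℕ) (hm : Odd m) (ζ : ℂ) (hζ : IsPrimitiveRoot ζ (2 * m + 1)) :
    (∏ k ∈ Finset.range m, (ζ ^ (2 * k + 1) - ζ ^ (2 * m + 1 - (2 * k + 1)))) ^ 2 =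
      -((2 * m + 1 : ℕ) : ℂ) := by
  have h2 : IsPrimitiveRoot (ζ ^ 2) (2 * m + 1) :=
    hζ.pow_of_coprime 2 (Nat.coprime_two_left.2 ⟨m, rfl⟩)
  have hprod := (show IsPrimitiveRoot (ζ ^ 2) (2 * m + 1) from h2).prod_one_sub_pow_eq_order
  have hpair : ∏ k ∈ Finset.range (2 * m), (1 - (ζ ^ 2) ^ (k + 1)) =
      ∏ k ∈ Finset.range m, ((1 - (ζ ^ 2) ^ (2 * k + 1)) *
        (1 - (ζ ^ 2) ^ (2 * m + 1 - (2 * k + 1)))) := by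
    rw [Finset.prod_mul_distrib, ← Finset.prod_range_reflect (fun k =>
      (1 - (ζ ^ 2) ^ (2 * m + 1 - (2 * k + 1)))), ← Finset.prod_mul_distrib]
    have : ∀ n ≤ m, ∏ k ∈ Finset.range (2 * n), (1 - (ζ ^ 2) ^ (k + 1)) =
        ∏ k ∈ Finset.range n, ((1 - (ζ ^ 2) ^ (2 * k + 1)) *
        (1 - (ζ ^ 2) ^ (2 * m + 1 - (2 * (m - 1 - k) + 1)))) := by
      intro n hn
      induction n with
      | zero => simp
      | succ n ih =>
        rw [Finset.prod_range_succ, ← ih (by omega), show 2 * (n + 1) = 2 * n + 1 + 1 by ring,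
          Finset.prod_range_succ, Finset.prod_range_succ,
          show 2 * m + 1 - (2 * (m - 1 - n) + 1) = 2 * n + 1 + 1 by omega, mul_assoc]
    exact this m le_rfl
  rw [hpair] at hprod
  have hk : ∀ k ∈ Finset.range m, (ζ ^ (2 * k + 1) - ζ ^ (2 * m + 1 - (2 * k + 1))) ^ 2 =
      (-1) * ((1 - (ζ ^ 2) ^ (2 * k + 1)) * (1 - (ζ ^ 2) ^ (2 * m + 1 - (2 * k + 1)))) := by
    intro k hk
    rw [Finset.mem_range] at hk
    have h1 : ζ ^ (2 * k + 1) * ζ ^ (2 * m + 1 - (2 * k + 1)) = 1 := by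
      rw [← pow_add, show 2 * k + 1 + (2 * m + 1 - (2 * k + 1)) = 2 * m + 1 by omega, hζ.pow_eq_one]
    simp only [← pow_mul, mul_comm 2 (2 * k + 1), mul_comm 2 (2 * m + 1 - (2 * k + 1))]
    simp only [pow_mul]
    linear_combination (ζ ^ (2 * k + 1) * ζ ^ (2 * m + 1 - (2 * k + 1)) - 1) * h1
  rw [← Finset.prod_pow, Finset.prod_congr rfl hk, Finset.prod_mul_distrib, hprod,
    Finset.prod_const, Finset.card_range, hm.neg_one_pow]
  push_cast
  ring

theorem exists_pos_prod_odd_pow_sub_eq (l : ℕ) :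
    ∃ r : ℝ, 0 < r ∧ ∏ k ∈ Finset.range (2 * l + 1),
      (Complex.exp (2 * Real.pi * Complex.I / (4 * l + 3 : ℕ)) ^ (2 * k + 1) -
        Complex.exp (2 * Real.pi * Complex.I / (4 * l + 3 : ℕ)) ^ (4 * l + 3 - (2 * k + 1))) =
      Complex.I * r := by
  have hpos : (0 : ℝ) < (4 * l + 3 : ℕ) := by positivity
  have hne : ((4 * l + 3 : ℕ) : ℂ) ≠ 0 := by exact_mod_cast hpos.ne'
  set s : ℕ → ℝ := fun k => Real.sin (2 * Real.pi * (2 * k + 1) / (4 * l + 3 : ℕ)) with hs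
  have hterm : ∀ k ∈ Finset.range (2 * l + 1),
      (Complex.exp (2 * Real.pi * Complex.I / (4 * l + 3 : ℕ)) ^ (2 * k + 1) -
        Complex.exp (2 * Real.pi * Complex.I / (4 * l + 3 : ℕ)) ^ (4 * l + 3 - (2 * k + 1))) =
      (2 * Complex.I) * (s k : ℂ) := by
    intro k hk
    rw [Finset.mem_range] at hk
    have e1 : Complex.exp (2 * Real.pi * Complex.I / (4 * l + 3 : ℕ)) ^ (2 * k + 1) =
        Complex.exp ((2 * Real.pi * (2 * k + 1) / (4 * l + 3 : ℕ) : ℂ) * Complex.I) := by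
      rw [← Complex.exp_nat_mul]; congr 1; push_cast; ring
    have e2 : Complex.exp (2 * Real.pi * Complex.I / (4 * l + 3 : ℕ)) ^ (4 * l + 3 - (2 * k + 1)) =
        Complex.exp (-(2 * Real.pi * (2 * k + 1) / (4 * l + 3 : ℕ) : ℂ) * Complex.I) := by
      rw [← Complex.exp_nat_mul, Complex.exp_eq_exp_iff_exists_int]
      refine ⟨1, ?_⟩
      rw [Nat.cast_sub (by omega)]
      field_simp
      push_cast
      ring
    rw [e1, e2, hs]
    push_cast
    rw [Complex.sin]
    ring_nf
    rw [Complex.I_sq]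
    ring
  have hfirst : 0 < ∏ k ∈ Finset.range (l + 1), s k := by
    refine Finset.prod_pos fun k hk => Real.sin_pos_of_pos_of_lt_pi (by positivity) ?_
    rw [Finset.mem_range] at hk
    rw [div_lt_iff₀ hpos, mul_comm 2 Real.pi, mul_assoc]
    have : (2 * (2 * k + 1) : ℝ) < (4 * l + 3 : ℕ) := by exact_mod_cast (by omega)
    exact mul_lt_mul_of_pos_left this Real.pi_pos
  have hsecond : 0 < ∏ k ∈ Finset.range l, -s (l + 1 + k) := by
    refine Finset.prod_pos fun k hk => ?_
    rw [Finset.mem_range] at hk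
    rw [hs, neg_pos]
    have h1 : Real.pi < 2 * Real.pi * (2 * ((l + 1 + k : ℕ) : ℝ) + 1) / (4 * l + 3 : ℕ) := by
      rw [lt_div_iff₀ hpos, mul_comm 2 Real.pi, mul_assoc]
      have : ((4 * l + 3 : ℕ) : ℝ) < 2 * (2 * ((l + 1 + k : ℕ) : ℝ) + 1) := by
        exact_mod_cast (by omega)
      exact mul_lt_mul_of_pos_left this Real.pi_pos
    have h2 : 2 * Real.pi * (2 * ((l + 1 + k : ℕ) : ℝ) + 1) / (4 * l + 3 : ℕ) < 2 * Real.pi := by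
      rw [div_lt_iff₀ hpos]
      have : (2 * ((l + 1 + k : ℕ) : ℝ) + 1) < ((4 * l + 3 : ℕ) : ℝ) := by
        exact_mod_cast (by omega)
      exact mul_lt_mul_of_pos_left this (by positivity)
    beta_reduce
    rw [← Real.sin_sub_two_pi]
    exact Real.sin_neg_of_neg_of_neg_pi_lt (by linarith) (by linarith)
  refine ⟨2 ^ (2 * l + 1) * ((∏ k ∈ Finset.range (l + 1), s k) *
    ∏ k ∈ Finset.range l, -s (l + 1 + k)), by positivity, ?_⟩
  rw [Finset.prod_congr rfl hterm, Finset.prod_mul_distrib, Finset.prod_const, Finset.card_range,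
    show 2 * l + 1 = l + 1 + l by ring, Finset.prod_range_add, Finset.prod_neg, Finset.card_range]
  push_cast
  rw [mul_pow, show l + 1 + l = 2 * l + 1 by ring, pow_succ Complex.I, pow_mul Complex.I,
    Complex.I_sq]
  ring

/-- The value of the quadratic Gauss sum, including its sign. -/
theorem sum_legendreSym_mul_exp_pow (p : ℕ) [Fact p.Prime] (hp4 : p % 4 = 3) :
    ∑ a ∈ Finset.range p, (legendreSym p a : ℂ) *
      Complex.exp (2 * Real.pi * Complex.I / p) ^ a = Complex.I * √(p : ℝ) := by
  have hp : p.Prime := Fact.out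
  have hp2 : p ≠ 2 := by rintro rfl; norm_num at hp4
  set ζ := Complex.exp (2 * Real.pi * Complex.I / p) with hζ
  have hprim : IsPrimitiveRoot ζ p := Complex.isPrimitiveRoot_exp p hp.ne_zero
  set G := ∑ a ∈ Finset.range p, (legendreSym p a : ℂ) * ζ ^ a with hG
  obtain ⟨l, hl⟩ : ∃ l, p = 4 * l + 3 := ⟨p / 4, by omega⟩
  set φ := ∏ k ∈ Finset.range (2 * l + 1), (ζ ^ (2 * k + 1) - ζ ^ (p - (2 * k + 1))) with hφ
  have hφsq : φ ^ 2 = -(p : ℂ) := by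
    have h := sq_prod_odd_pow_sub (2 * l + 1) ⟨l, rfl⟩ ζ (by convert hprim using 1; omega)
    rw [show 2 * (2 * l + 1) + 1 = p by omega] at h
    exact h
  obtain ⟨r, hr, hφr⟩ : ∃ r : ℝ, 0 < r ∧ φ = Complex.I * r := by
    have h := exists_pos_prod_odd_pow_sub_eq l
    rw [← hl] at h
    exact h
  have hr2 : r = √(p : ℝ) := by
    symm
    rw [Real.sqrt_eq_iff_mul_self_eq (by positivity) hr.le]
    rw [hφr, mul_pow, Complex.I_sq] at hφsq
    have : ((r * r : ℝ) : ℂ) = ((p : ℝ) : ℂ) := by push_cast; linear_combination -hφsq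
    exact_mod_cast this.symm
  have hGsq : G ^ 2 = -(p : ℂ) := by
    set χ : MulChar (ZMod p) ℂ := (quadraticChar (ZMod p)).ringHomComp (Int.castRingHom ℂ) with hχ
    have hchar : ringChar (ZMod p) ≠ 2 := by rwa [ZMod.ringChar_zmod_n]
    have hχ1 : χ ≠ 1 := by
      rw [hχ, Ne, MulChar.ringHomComp_eq_one_iff Int.cast_injective]
      exact quadraticChar_ne_one hchar
    have h := gaussSum_sq hχ1 ((quadraticChar_isQuadratic (ZMod p)).comp _)
      (ZMod.isPrimitive_stdAddChar p)
    have hg : gaussSum χ (ZMod.stdAddChar (N := p)) = G := by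
      rw [gaussSum, ZMod.sum_eq_sum_range, hG]
      refine Finset.sum_congr rfl fun a _ => ?_
      congr 1
      · simp [hχ, legendreSym]
      · have := ZMod.stdAddChar_coe (N := p) (a : ℤ)
        rw [Int.cast_natCast] at this
        rw [this, hζ, ← Complex.exp_nat_mul]
        congr 1
        push_cast
        ring
    have hneg : χ (-1) = -1 := by
      have : legendreSym p (-1) = -1 := by
        rw [legendreSym.at_neg_one hp2, ZMod.χ₄_nat_three_mod_four hp4]
      rw [legendreSym] at this
      push_cast at this
      simp [hχ, this]
    rw [hg, hneg, ZMod.card] at h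
    linear_combination h
  obtain ⟨ε, hε, hGφ⟩ : ∃ ε : ℤ, (ε = 1 ∨ ε = -1) ∧ G = ε * φ := by
    rcases sq_eq_sq_iff_eq_or_eq_neg.1 (hGsq.trans hφsq.symm) with h | h
    · exact ⟨1, Or.inl rfl, by simpa using h⟩
    · exact ⟨-1, Or.inr rfl, by simpa using h⟩
  have hε1 : ε = 1 := by
    refine eq_one_of_cyclotomic_dvd_sub p (2 * l + 1) (by omega) ε hε ?_
    rw [Polynomial.cyclotomic_eq_minpoly hprim hp.pos]
    refine minpoly.isIntegrallyClosed_dvd (hprim.isIntegral hp.pos) ?_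
    simp only [map_sub, map_mul, map_sum, map_prod, map_pow, Polynomial.aeval_X,
      eq_intCast, map_intCast]
    rw [← hG, ← hφ, hGφ, sub_self]
  rw [hGφ, hε1, hφr, hr2]
  simp

theorem sum_range_legendreSym_eq_zero (p : ℕ) [Fact p.Prime] (hp2 : p ≠ 2) :
    ∑ a ∈ Finset.range p, legendreSym p a = 0 := by
  have h := quadraticChar_sum_zero (F := ZMod p) (by rwa [ZMod.ringChar_zmod_n])
  rw [ZMod.sum_eq_sum_range] at h
  simpa [legendreSym] using h

theorem legendreSym_two_sub_two_mul_sum (p : ℕ) [Fact p.Prime] (hp2 : p ≠ 2) :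
    (legendreSym p 2 - 2) * ∑ a ∈ Finset.range p, (a : ℤ) * legendreSym p a =
      p * ∑ a ∈ Finset.range ((p + 1) / 2), legendreSym p a := by
  have hp : p.Prime := Fact.out
  have hodd : p % 2 = 1 := hp.eq_two_or_odd.resolve_left hp2
  set S := ∑ a ∈ Finset.range ((p + 1) / 2), legendreSym p a with hS
  set T := ∑ a ∈ Finset.range p, (a : ℤ) * legendreSym p a with hT
  have h2 : ((2 : ℤ) : ZMod p) ≠ 0 := by
    have := (ZMod.natCast_eq_zero_iff 2 p).not.2
      (fun h => hp2 ((Nat.prime_dvd_prime_iff_eq hp Nat.prime_two).1 h))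
    exact_mod_cast this
  have hsplit : ∑ a ∈ Finset.Ico ((p + 1) / 2) p, legendreSym p a = -S := by
    have := Finset.sum_range_add_sum_Ico (fun a : ℕ => legendreSym p a)
      (show (p + 1) / 2 ≤ p by have := hp.two_le; omega)
    rw [sum_range_legendreSym_eq_zero p hp2] at this
    linarith
  have hdouble : T = ∑ a ∈ Finset.range p, (((2 * a) % p : ℕ) : ℤ) * legendreSym p (2 * a) := by
    symm
    refine Finset.sum_bij (fun a _ => (2 * a) % p) ?_ ?_ ?_ ?_
    · intro a _; exact Finset.mem_range.2 (Nat.mod_lt _ hp.pos)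
    · intro a ha b hb hab
      rw [Finset.mem_range] at ha hb
      exact (Nat.ModEq.cancel_left_of_coprime
        (by simpa using (Nat.coprime_primes hp Nat.prime_two).2 hp2) hab).eq_of_lt_of_lt ha hb
    · intro c hc
      rw [Finset.mem_range] at hc
      rcases Nat.even_or_odd' c with ⟨k, rfl | rfl⟩
      · exact ⟨k, Finset.mem_range.2 (by omega), Nat.mod_eq_of_lt hc⟩
      · refine ⟨(2 * k + 1 + p) / 2, Finset.mem_range.2 (by omega), ?_⟩
        rw [show 2 * ((2 * k + 1 + p) / 2) = 2 * k + 1 + p by omega, Nat.add_mod_right,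
          Nat.mod_eq_of_lt hc]
    · intro a _
      congr 1
      simp [legendreSym]
  have hval : ∀ a ∈ Finset.range p, (((2 * a) % p : ℕ) : ℤ) =
      2 * a - if (p + 1) / 2 ≤ a then (p : ℤ) else 0 := by
    intro a ha
    rw [Finset.mem_range] at ha
    split_ifs with h
    · rw [Nat.mod_eq_sub_mod (by omega), Nat.mod_eq_of_lt (by omega)]; omega
    · rw [Nat.mod_eq_of_lt (by omega)]; simp
  have hind : ∑ a ∈ Finset.range p, (if (p + 1) / 2 ≤ a then (p : ℤ) else 0) * legendreSym p a =
      p * -S := by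
    rw [← hsplit, Finset.mul_sum]
    simp only [ite_mul, zero_mul]
    rw [← Finset.sum_filter]
    refine Finset.sum_congr ?_ fun _ _ => rfl
    ext a; simp [and_comm]
  have hsq : legendreSym p 2 ^ 2 = 1 := legendreSym.sq_one p h2
  have : T = legendreSym p 2 * (2 * T - p * -S) := by
    rw [← hind, hT, Finset.mul_sum, ← Finset.sum_sub_distrib, Finset.mul_sum, ← hT, hdouble]
    refine Finset.sum_congr rfl fun a ha => ?_
    rw [hval a ha, legendreSym.mul]
    ring
  linear_combination legendreSym p 2 * this + (2 * T + p * S) * hsq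
    

theorem neg_sum_range_mul_legendreSym_lt (p : ℕ) [Fact p.Prime] :
    -∑ a ∈ Finset.range p, (a : ℤ) * legendreSym p a < p * p := by
  have hp : p.Prime := Fact.out
  have : ∑ a ∈ Finset.range p, -((a : ℤ) * legendreSym p a) < ∑ a ∈ Finset.range p, (p : ℤ) := by
    refine Finset.sum_lt_sum_of_nonempty ⟨0, Finset.mem_range.2 hp.pos⟩ fun a ha => ?_
    have ha' : (a : ℤ) < p := by exact_mod_cast Finset.mem_range.1 ha
    have h1 : -1 ≤ legendreSym p a := by
      rcases eq_or_ne ((a : ℤ) : ZMod p) 0 with h | h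
      · rw [(legendreSym.eq_zero_iff p a).2 h]; norm_num
      · rcases legendreSym.eq_one_or_neg_one p h with h | h <;> rw [h]; norm_num
    nlinarith [Int.natCast_nonneg a]
  simpa using this

open Filter Topology

theorem abs_rpow_neg_sub_rpow_neg_le {a b c s : ℝ} (hc : 1 ≤ c) (ha : c ≤ a) (hb : c ≤ b)
    (hs1 : 1 ≤ s) (hs2 : s ≤ 2) : |a ^ (-s) - b ^ (-s)| ≤ 2 / c ^ 2 * |a - b| := by
  refine (convex_Ici c).norm_image_sub_le_of_norm_hasDerivWithin_le
    (f := fun x : ℝ => x ^ (-s)) (f' := fun x => -s * x ^ (-s - 1)) (fun x hx => ?_)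
    (fun x hx => ?_) hb ha
  · have hx0 : 0 < x := by have := Set.mem_Ici.1 hx; linarith
    exact (Real.hasDerivAt_rpow_const (Or.inl hx0.ne')).hasDerivWithinAt
  · have hcx : c ≤ x := hx
    have hx0 : 0 < x := by linarith
    rw [norm_mul, norm_neg, Real.norm_of_nonneg (by linarith), Real.norm_of_nonneg (by positivity)]
    have h1 : x ^ (-s - 1) ≤ 1 / c ^ 2 := calc
      x ^ (-s - 1) ≤ x ^ (-2 : ℝ) :=
        Real.rpow_le_rpow_of_exponent_le (by linarith) (by linarith)
      _ = 1 / x ^ 2 := by rw [Real.rpow_neg hx0.le]; norm_cast; rw [one_div]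
      _ ≤ 1 / c ^ 2 := by gcongr
    calc s * x ^ (-s - 1) ≤ 2 * (1 / c ^ 2) := by gcongr
      _ = _ := by ring

/-- `∑ₘ ((d m + a)⁻ˢ - (d m + d - a)⁻ˢ)`. -/
noncomputable def pairedHurwitz (d a : ℕ) (s : ℝ) : ℝ :=
  ∑' m : ℕ, (((a + d * m : ℕ) : ℝ) ^ (-s) - ((d - a + d * m : ℕ) : ℝ) ^ (-s))

theorem abs_paired_term_le {d a : ℕ} (ha : 0 < a) (had : a < d) (m : ℕ) {s : ℝ}
    (hs : s ∈ Set.Icc (1 : ℝ) 2) :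
    ‖((a + d * m : ℕ) : ℝ) ^ (-s) - ((d - a + d * m : ℕ) : ℝ) ^ (-s)‖ ≤
      2 * d * (1 / ((m + 1 : ℕ) : ℝ) ^ 2) := by
  have hd : m ≤ d * m := Nat.le_mul_of_pos_left m (by omega)
  refine (abs_rpow_neg_sub_rpow_neg_le (c := ((m + 1 : ℕ) : ℝ)) (by simp)
    (by exact_mod_cast (by omega)) (by exact_mod_cast (by omega)) hs.1 hs.2).trans ?_
  have : |((a + d * m : ℕ) : ℝ) - ((d - a + d * m : ℕ) : ℝ)| ≤ d := by
    rw [Nat.cast_add a, Nat.cast_add (d - a), Nat.cast_sub had.le, abs_le]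
    have h1 : (a : ℝ) ≤ d := by exact_mod_cast had.le
    have h2 : (0 : ℝ) ≤ a := by positivity
    constructor <;> linarith
  calc _ ≤ 2 / ((m + 1 : ℕ) : ℝ) ^ 2 * d := by gcongr
    _ = _ := by ring

theorem summable_paired_bound (d : ℕ) :
    Summable fun m : ℕ => 2 * (d : ℝ) * (1 / ((m + 1 : ℕ) : ℝ) ^ 2) :=
  ((summable_nat_add_iff 1).2 (Real.summable_one_div_nat_pow.2 one_lt_two)).mul_left _

theorem continuousOn_pairedHurwitz {d a : ℕ} (ha : 0 < a) (had : a < d) :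
    ContinuousOn (pairedHurwitz d a) (Set.Icc 1 2) := by
  refine continuousOn_tsum (fun m => ?_) (summable_paired_bound d)
    fun m s hs => abs_paired_term_le ha had m hs
  have h1 : ((a + d * m : ℕ) : ℝ) ≠ 0 := by exact_mod_cast (by omega)
  have h2 : ((d - a + d * m : ℕ) : ℝ) ≠ 0 := by exact_mod_cast (by omega)
  refine Continuous.continuousOn ?_
  exact (Real.continuous_const_rpow h1).comp continuous_neg |>.sub
    ((Real.continuous_const_rpow h2).comp continuous_neg)

theorem pairedHurwitz_one {d a : ℕ} (ha : 0 < a) (had : a < d) :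
    (pairedHurwitz d a 1 : ℂ) = Real.pi / d * Complex.cot (Real.pi * (a / d)) := by
  have hd0 : (d : ℂ) ≠ 0 := by exact_mod_cast (by omega)
  have ha0 : (a : ℂ) ≠ 0 := by exact_mod_cast (by omega)
  have hx : ((a : ℂ) / d) ∈ Complex.integerComplement := by
    rw [Complex.mem_integerComplement_iff]
    rintro ⟨n, hn⟩
    rw [eq_div_iff hd0] at hn
    have h : n * d = a := by exact_mod_cast hn
    rcases le_or_gt n 0 with h0 | h0
    · nlinarith
    · nlinarith
  have hsum : HasSum (fun m : ℕ => ((a + d * m : ℕ) : ℝ) ^ (-1 : ℝ) -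
      ((d - a + d * m : ℕ) : ℝ) ^ (-1 : ℝ)) (pairedHurwitz d a 1) :=
    (Summable.of_norm_bounded (summable_paired_bound d)
      fun m => abs_paired_term_le ha had m (by norm_num)).hasSum
  have h1 := (Complex.continuous_ofReal.tendsto _).comp hsum.tendsto_sum_nat
  have h2 := (summable_cotTerm hx).hasSum.tendsto_sum_nat
  have hrep : (∑' n, cotTerm ((a : ℂ) / d) n) = _ := (cot_series_rep' hx).symm
  rw [hrep] at h2
  have h3 : Tendsto (fun N : ℕ => 1 / (((a : ℂ) / d) + N)) atTop (𝓝 0) := by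
    have h := tendsto_inv_atTop_zero.comp
      (tendsto_atTop_add_const_left atTop ((a : ℝ) / d) (tendsto_natCast_atTop_atTop (R := ℝ)))
    simpa [Function.comp_def] using (Complex.continuous_ofReal.tendsto _).comp h
  have h4 := ((h2.const_add (1 / ((a : ℂ) / d))).sub h3).const_mul (1 / (d : ℂ))
  refine tendsto_nhds_unique h1 (Tendsto.congr (fun N => ?_) (h4.trans_eq ?_))
  · induction N with
    | zero => simp
    | succ N ih =>
      have hN : (a : ℂ) / d + N ≠ 0 := by
        simpa using Complex.integerComplement_add_ne_zero hx N
      have hN' : (a : ℂ) / d - (N + 1) ≠ 0 := by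
        simpa [sub_eq_add_neg] using Complex.integerComplement_add_ne_zero hx (-(N + 1))
      have hterm : (1 / (d : ℂ)) * (1 / ((a : ℂ) / d - (N + 1)) + 1 / ((a : ℂ) / d + N)) =
          ((((a + d * N : ℕ) : ℝ) ^ (-1 : ℝ) - ((d - a + d * N : ℕ) : ℝ) ^ (-1 : ℝ) : ℝ) : ℂ) := by
        rw [Real.rpow_neg_one, Real.rpow_neg_one]
        push_cast [Nat.cast_sub had.le]
        have e1 : (a : ℂ) / d + N = (a + d * N) / d := by field_simp
        have e2 : (a : ℂ) / d - (N + 1) = -(d - a + d * N) / d := by field_simp; ring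
        rw [e1, div_ne_zero_iff] at hN
        rw [e2, div_ne_zero_iff, neg_ne_zero] at hN'
        rw [e1, e2]
        have := hN.1
        have := hN'.1
        field_simp
        ring
      simp only [Function.comp_apply] at ih ⊢
      rw [Finset.sum_range_succ, Finset.sum_range_succ, Complex.ofReal_add, ← ih, ← hterm]
      push_cast
      ring
  · congr 1; field_simp; ring

theorem summable_legendreSym_mul_rpow_neg (p : ℕ) [Fact p.Prime] {s : ℝ} (hs : 1 < s) :
    Summable fun n : ℕ => (legendreSym p n : ℝ) * (n : ℝ) ^ (-s) := by
  refine Summable.of_norm_bounded (Real.summable_nat_rpow.2 (by linarith : -s < -1)) fun n => ?_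
  rw [norm_mul, Real.norm_of_nonneg (r := (n : ℝ) ^ (-s)) (by positivity)]
  refine mul_le_of_le_one_left (by positivity) ?_
  rcases quadraticChar_isQuadratic (ZMod p) ((n : ℤ) : ZMod p) with h | h | h <;>
    simp only [legendreSym, h] <;> simp

theorem summable_nat_add_mul_rpow_neg {d : ℕ} (hd : 0 < d) (a : ℕ) {s : ℝ} (hs : 1 < s) :
    Summable fun m : ℕ => ((a + d * m : ℕ) : ℝ) ^ (-s) :=
  (Real.summable_nat_rpow.2 (by linarith : -s < -1)).comp_injective
    (i := fun m => a + d * m) fun x y h => by simpa [hd.ne'] using h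

theorem two_mul_tsum_legendreSym (p : ℕ) [Fact p.Prime] (hp4 : p % 4 = 3) {s : ℝ} (hs : 1 < s) :
    2 * ∑' n : ℕ, (legendreSym p n : ℝ) * (n : ℝ) ^ (-s) =
      ∑ a ∈ Finset.range p, (legendreSym p a : ℝ) * pairedHurwitz p a s := by
  have hp : p.Prime := Fact.out
  have hp2 : p ≠ 2 := by rintro rfl; norm_num at hp4
  set H : ℕ → ℝ := fun a => ∑' m : ℕ, ((a + p * m : ℕ) : ℝ) ^ (-s) with hH
  have h1 : ∑' n : ℕ, (legendreSym p n : ℝ) * (n : ℝ) ^ (-s) =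
      ∑ j : ZMod p, (quadraticChar (ZMod p) j : ℝ) * H j.val := by
    rw [Nat.sumByResidueClasses (summable_legendreSym_mul_rpow_neg p hs) p]
    refine Finset.sum_congr rfl fun j _ => ?_
    rw [← tsum_mul_left]
    refine tsum_congr fun m => ?_
    simp [legendreSym]
  have hneg : quadraticChar (ZMod p) (-1) = -1 := by
    have : legendreSym p (-1) = -1 := by
      rw [legendreSym.at_neg_one hp2, ZMod.χ₄_nat_three_mod_four hp4]
    simpa [legendreSym] using this
  have h2 : ∑ j : ZMod p, (quadraticChar (ZMod p) j : ℝ) * H j.val =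
      ∑ j : ZMod p, -((quadraticChar (ZMod p) j : ℝ) * H (p - j.val)) := by
    rw [← Equiv.sum_comp (Equiv.neg (ZMod p))]
    refine Finset.sum_congr rfl fun j _ => ?_
    by_cases hj : j = 0
    · simp [hj]
    · have : NeZero j := ⟨hj⟩
      rw [Equiv.neg_apply, ZMod.val_neg_of_ne_zero, ← neg_one_mul j, map_mul, hneg]
      push_cast
      ring
  have h3 : ∑ a ∈ Finset.range p, (legendreSym p a : ℝ) * pairedHurwitz p a s =
      ∑ j : ZMod p, (quadraticChar (ZMod p) j : ℝ) * pairedHurwitz p j.val s := by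
    rw [ZMod.sum_eq_sum_range]
    refine Finset.sum_congr rfl fun a ha => ?_
    rw [ZMod.val_cast_of_lt (Finset.mem_range.1 ha)]
    simp [legendreSym]
  rw [h3, two_mul, h1]
  nth_rw 2 [h2]
  rw [← Finset.sum_add_distrib]
  refine Finset.sum_congr rfl fun j _ => ?_
  rw [pairedHurwitz, Summable.tsum_sub (summable_nat_add_mul_rpow_neg hp.pos _ hs)
    (summable_nat_add_mul_rpow_neg hp.pos _ hs)]
  ring

theorem cot_pi_mul_div_eq_sum {p a : ℕ} (ha : 0 < a) (hap : a < p) :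
    Complex.cot (Real.pi * (a / p)) = Complex.I + 2 * Complex.I / p *
      ∑ j ∈ Finset.range p, (j : ℂ) * Complex.exp (2 * Real.pi * Complex.I / p) ^ (a * j) := by
  have hprim := Complex.isPrimitiveRoot_exp p (by omega)
  set ζ := Complex.exp (2 * Real.pi * Complex.I / p) with hζ
  have hp0 : (p : ℂ) ≠ 0 := by exact_mod_cast (by omega)
  have hw : ζ ^ a ≠ 1 := hprim.pow_ne_one_of_pos_of_lt ha.ne' hap
  have hw' : ζ ^ a - 1 ≠ 0 := sub_ne_zero.2 hw
  have hwp : (ζ ^ a) ^ p = 1 := by rw [← pow_mul, mul_comm, pow_mul, hprim.pow_eq_one, one_pow]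
  have htel : ∀ (w : ℂ) (n : ℕ), (w - 1) * ∑ j ∈ Finset.range n, (j : ℂ) * w ^ j =
      n * w ^ n - w * ∑ j ∈ Finset.range n, w ^ j := by
    intro w n
    induction n with
    | zero => simp
    | succ n ih =>
      rw [Finset.sum_range_succ, Finset.sum_range_succ, mul_add, ih]
      push_cast
      ring
  have hgeom : ∑ j ∈ Finset.range p, (ζ ^ a) ^ j = 0 := by
    have := geom_sum_mul (ζ ^ a) p
    rw [hwp, sub_self] at this
    exact (mul_eq_zero.1 this).resolve_right hw'
  have hsum := htel (ζ ^ a) p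
  rw [hwp, hgeom, mul_zero, sub_zero, mul_one] at hsum
  simp only [pow_mul]
  rw [Complex.cot_pi_eq_exp_ratio, show Complex.exp (2 * Real.pi * Complex.I * (a / p)) = ζ ^ a by
    rw [hζ, ← Complex.exp_nat_mul]; congr 1; ring]
  have hw'' : 1 - ζ ^ a ≠ 0 := by rw [← neg_sub, neg_ne_zero]; exact hw'
  rw [show ∑ j ∈ Finset.range p, (j : ℂ) * (ζ ^ a) ^ j = p / (ζ ^ a - 1) by
    rw [eq_div_iff hw', mul_comm]; exact hsum]
  rw [← neg_sub (ζ ^ a) 1]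
  field_simp
  rw [Complex.I_sq]
  ring

theorem sum_legendreSym_mul_exp_pow_mul (p : ℕ) [Fact p.Prime] (hp4 : p % 4 = 3) {j : ℕ}
    (hj0 : 0 < j) (hjp : j < p) :
    ∑ a ∈ Finset.range p, (legendreSym p a : ℂ) *
      Complex.exp (2 * Real.pi * Complex.I / p) ^ (a * j) =
      legendreSym p j * (Complex.I * √(p : ℝ)) := by
  have hp : p.Prime := Fact.out
  have hprim := Complex.isPrimitiveRoot_exp p hp.ne_zero
  rw [← sum_legendreSym_mul_exp_pow p hp4]
  set ζ := Complex.exp (2 * Real.pi * Complex.I / p) with hζ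
  have hj : ((j : ℤ) : ZMod p) ≠ 0 := by
    rw [Int.cast_natCast, Ne, ZMod.natCast_eq_zero_iff]
    exact Nat.not_dvd_of_pos_of_lt hj0 hjp
  have hj' : (j : ZMod p) ≠ 0 := by simpa using hj
  have hmod : ∀ m : ℕ, ζ ^ m = ζ ^ (m % p) := fun m => pow_eq_pow_mod m hprim.pow_eq_one
  have key : ∑ a ∈ Finset.range p, (legendreSym p a : ℂ) * ζ ^ a =
      ∑ a ∈ Finset.range p, (legendreSym p (a * j : ℕ) : ℂ) * ζ ^ (a * j) := by
    have e := ZMod.sum_eq_sum_range p (fun x : ZMod p => (quadraticChar (ZMod p) x : ℂ) * ζ ^ x.val)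
    have e' := ZMod.sum_eq_sum_range p
      (fun x : ZMod p => (quadraticChar (ZMod p) (x * j) : ℂ) * ζ ^ (x * j).val)
    rw [← Equiv.sum_comp (Equiv.mulRight₀ (j : ZMod p) hj')] at e
    simp only [Equiv.mulRight₀_apply] at e
    rw [e] at e'
    convert e' using 2 with a ha a ha
    · rw [ZMod.val_cast_of_lt (Finset.mem_range.1 ha)]; simp [legendreSym]
    · rw [← Nat.cast_mul, ZMod.val_natCast, ← hmod]; simp [legendreSym]
  rw [key, Finset.mul_sum]
  refine Finset.sum_congr rfl fun a _ => ?_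
  have hsq := legendreSym.sq_one p hj
  rw [Nat.cast_mul, legendreSym.mul]
  have hsq' : (legendreSym p j : ℂ) ^ 2 = 1 := by exact_mod_cast hsq
  push_cast
  linear_combination (-(legendreSym p a : ℂ) * ζ ^ (a * j)) * hsq'

theorem sum_legendreSym_mul_pairedHurwitz_one (p : ℕ) [Fact p.Prime] (hp4 : p % 4 = 3) :
    ∑ a ∈ Finset.range p, (legendreSym p a : ℝ) * pairedHurwitz p a 1 =
      -(2 * Real.pi / (p * √p)) * ∑ a ∈ Finset.range p, (a : ℝ) * legendreSym p a := by
  have hp : p.Prime := Fact.out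
  have hp2 : p ≠ 2 := by rintro rfl; norm_num at hp4
  have hp0 : (p : ℂ) ≠ 0 := by exact_mod_cast hp.ne_zero
  rw [← Complex.ofReal_inj]
  push_cast
  have h1 : ∀ a ∈ Finset.range p, (legendreSym p a : ℂ) * pairedHurwitz p a 1 =
      legendreSym p a * (Real.pi / p * Complex.I) +
      ∑ j ∈ Finset.range p, Real.pi / p * (2 * Complex.I / p) * (j * ((legendreSym p a : ℂ) *
        Complex.exp (2 * Real.pi * Complex.I / p) ^ (a * j))) := by
    intro a ha
    rcases Nat.eq_zero_or_pos a with rfl | ha0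
    · simp
    · rw [pairedHurwitz_one ha0 (Finset.mem_range.1 ha),
        cot_pi_mul_div_eq_sum ha0 (Finset.mem_range.1 ha), mul_add, mul_add, Finset.mul_sum,
        Finset.mul_sum, Finset.mul_sum]
      refine congrArg₂ _ (by ring) (Finset.sum_congr rfl fun j _ => by ring)
  rw [Finset.sum_congr rfl h1, Finset.sum_add_distrib, ← Finset.sum_mul, Finset.sum_comm]
  have h0 : ∑ a ∈ Finset.range p, (legendreSym p a : ℂ) = 0 := by
    exact_mod_cast sum_range_legendreSym_eq_zero p hp2
  rw [h0, zero_mul, zero_add, Finset.mul_sum]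
  refine Finset.sum_congr rfl fun j hj => ?_
  rw [← Finset.mul_sum, ← Finset.mul_sum]
  rcases Nat.eq_zero_or_pos j with rfl | hj0
  · simp
  · rw [sum_legendreSym_mul_exp_pow_mul p hp4 hj0 (Finset.mem_range.1 hj)]
    have hsq : ((√(p : ℝ) : ℝ) : ℂ) ^ 2 = p := by
      rw [← Complex.ofReal_pow, Real.sq_sqrt (by positivity)]; simp
    have hs0 : ((√(p : ℝ) : ℝ) : ℂ) ≠ 0 := by
      intro h; rw [h] at hsq; exact hp0 (by simpa using hsq.symm)
    field_simp
    rw [Complex.I_sq, hsq]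
    ring

theorem tendsto_tsum_legendreSym (p : ℕ) [Fact p.Prime] (hp4 : p % 4 = 3) :
    Tendsto (fun s : ℝ => ∑' n : ℕ, (legendreSym p n : ℝ) * (n : ℝ) ^ (-s)) (𝓝[>] 1)
      (𝓝 (-(Real.pi / (p * √p)) * ∑ a ∈ Finset.range p, (a : ℝ) * legendreSym p a)) := by
  have h : Tendsto (fun s : ℝ => (1 / 2) *
      ∑ a ∈ Finset.range p, (legendreSym p a : ℝ) * pairedHurwitz p a s) (𝓝[>] 1)
      (𝓝 ((1 / 2) * ∑ a ∈ Finset.range p, (legendreSym p a : ℝ) * pairedHurwitz p a 1)) := by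
    refine Tendsto.const_mul _ (tendsto_finsetSum _ fun a ha => ?_)
    rcases Nat.eq_zero_or_pos a with rfl | ha0
    · simp
    · have hc := (continuousOn_pairedHurwitz ha0 (Finset.mem_range.1 ha)) 1 (by norm_num)
      refine Tendsto.const_mul _ (hc.mono_left ?_)
      rw [← nhdsWithin_Ioc_eq_nhdsGT (one_lt_two : (1 : ℝ) < 2)]
      exact nhdsWithin_mono _ Set.Ioc_subset_Icc_self
  rw [sum_legendreSym_mul_pairedHurwitz_one p hp4] at h
  refine (h.congr' ?_).trans_eq (by congr 1; ring)
  filter_upwards [self_mem_nhdsWithin] with s hs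
  rw [← two_mul_tsum_legendreSym p hp4 hs]
  ring

open NumberField

/-- `1, ω` is a `ℤ`-basis of `R`, and `ω` is a root of `X² - X + c`. -/
structure IsQuadraticGenerator {R : Type*} [CommRing R] (c : ℕ) (ω : R) : Prop where
  mul_self : ω * ω = ω - c
  exists_eq : ∀ x : R, ∃ a b : ℤ, x = a + b * ω
  eq_zero : ∀ a b : ℤ, (a : R) + b * ω = 0 → a = 0 ∧ b = 0

theorem exists_rat_add_rat_mul_eq {K : Type*} [Field K] [NumberField K]
    (hrank : Module.finrank ℚ K = 2) {p : ℕ} (hp : 0 < p) {δ : K} (hδ : δ ^ 2 = -(p : K)) :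
    Algebra.trace ℚ K δ = 0 ∧ ∀ x : K, ∃ u v : ℚ, x = u + v * δ := by
  have hli : LinearIndependent ℚ ![(1 : K), δ] := by
    rw [LinearIndependent.pair_iff' one_ne_zero]
    intro a ha
    rw [← ha, smul_pow, one_pow] at hδ
    have h : a ^ 2 = -(p : ℚ) := by
      apply (algebraMap ℚ K).injective
      simpa [Algebra.smul_def] using hδ
    have : (0 : ℚ) < p := by exact_mod_cast hp
    nlinarith [sq_nonneg a]
  let b := basisOfLinearIndependentOfCardEqFinrank hli (by simp [hrank])
  have hb : ⇑b = ![(1 : K), δ] := coe_basisOfLinearIndependentOfCardEqFinrank hli _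
  have hb0 : b 0 = 1 := by rw [hb]; rfl
  have hb1 : b 1 = δ := by rw [hb]; rfl
  constructor
  · rw [Algebra.trace_eq_matrix_trace b, Matrix.trace_fin_two, Algebra.leftMulMatrix_eq_repr_mul,
      Algebra.leftMulMatrix_eq_repr_mul, hb0, mul_one, ← hb1, b.repr_self, hb1, ← sq, hδ,
      show -(p : K) = (-(p : ℚ)) • b 0 by rw [hb0, Algebra.smul_def]; simp, map_smul, b.repr_self]
    simp
  · intro x
    refine ⟨b.repr x 0, b.repr x 1, ?_⟩
    conv_lhs => rw [← b.sum_repr x, Fin.sum_univ_two, hb0, hb1]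
    simp [Algebra.smul_def]

theorem exists_intCast_eq_of_isIntegral_ratCast {q : ℚ} {K : Type*} [Field K] [CharZero K]
    (h : IsIntegral ℤ (q : K)) : ∃ n : ℤ, (n : ℚ) = q := by
  have h' : IsIntegral ℤ q := by
    rw [← isIntegral_algebraMap_iff (algebraMap ℚ K).injective]
    simpa using h
  exact IsIntegrallyClosed.isIntegral_iff.1 h'

theorem exists_isQuadraticGenerator {K : Type*} [Field K] [NumberField K]
    (hrank : Module.finrank ℚ K = 2) {p : ℕ} (hp : p.Prime) (hp4 : p % 4 = 3)
    (hsqrt : ∃ α : K, α ^ 2 = -(p : K)) :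
    ∃ ω : 𝓞 K, IsQuadraticGenerator ((p + 1) / 4) ω := by
  obtain ⟨δ, hδ⟩ := hsqrt
  obtain ⟨htr, hspan⟩ := exists_rat_add_rat_mul_eq hrank hp.pos hδ
  obtain ⟨c, hc⟩ : ∃ c : ℕ, p + 1 = 4 * c := ⟨(p + 1) / 4, by omega⟩
  rw [show (p + 1) / 4 = c by omega]
  have hcK : (p : K) + 1 = 4 * c := by exact_mod_cast hc
  have hδint : IsIntegral ℤ δ := by
    refine IsIntegral.of_pow two_pos ?_
    rw [hδ]
    exact (isIntegral_natCast p).neg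
  have hωeq : ((1 + δ) / 2) * ((1 + δ) / 2) = (1 + δ) / 2 - c := by
    field_simp
    linear_combination hδ - hcK
  have hωint : IsIntegral ℤ ((1 + δ) / 2) := by
    refine ⟨Polynomial.X ^ 2 - Polynomial.X + Polynomial.C (c : ℤ), by monicity!, ?_⟩
    simp only [Polynomial.eval₂_add, Polynomial.eval₂_sub, Polynomial.eval₂_pow,
      Polynomial.eval₂_X, Polynomial.eval₂_C]
    rw [sq, hωeq]
    simp
  obtain ⟨ω, hω⟩ : ∃ ω : 𝓞 K, algebraMap (𝓞 K) K ω = (1 + δ) / 2 := ⟨⟨_, hωint⟩, rfl⟩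
  refine ⟨ω, ?_, fun x => ?_, fun a b hab => ?_⟩
  · refine RingOfIntegers.coe_injective ?_
    simpa [hω] using hωeq
  · obtain ⟨u, v, hx⟩ := hspan x
    have hxint : IsIntegral ℤ (x : K) := x.isIntegral_coe
    have ht1 : Algebra.trace ℚ K (x : K) = 2 * u := by
      rw [hx, map_add, show (v : K) * δ = v • δ by rw [Algebra.smul_def]; simp, map_smul, htr,
        show (u : K) = algebraMap ℚ K u by simp, Algebra.trace_algebraMap, hrank]
      simp
    have ht2 : Algebra.trace ℚ K (δ * x) = -2 * p * v := by
      rw [hx, show δ * (u + v * δ) = u • δ + algebraMap ℚ K (-p * v) by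
        rw [Algebra.smul_def]; simp; linear_combination (v : K) * hδ, map_add, map_smul, htr,
        Algebra.trace_algebraMap, hrank]
      simp
      ring
    obtain ⟨A, hA⟩ : ∃ n : ℤ, (n : ℚ) = 2 * u :=
      ht1 ▸ IsIntegrallyClosed.isIntegral_iff.1 (Algebra.isIntegral_trace hxint)
    obtain ⟨B, hB⟩ : ∃ n : ℤ, (n : ℚ) = -2 * p * v :=
      ht2 ▸ IsIntegrallyClosed.isIntegral_iff.1 (Algebra.isIntegral_trace (hδint.mul hxint))
    have hAK : (A : K) = 2 * u := by exact_mod_cast congrArg (Rat.cast : ℚ → K) hA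
    obtain ⟨N, hN⟩ : ∃ n : ℤ, (n : ℚ) = u ^ 2 + p * v ^ 2 := by
      refine exists_intCast_eq_of_isIntegral_ratCast (K := K) ?_
      have : ((u ^ 2 + p * v ^ 2 : ℚ) : K) = A * x - x * x := by
        push_cast
        rw [hx, hAK]
        linear_combination (v : K) ^ 2 * hδ
      rw [this]
      exact ((isIntegral_intCast A).mul hxint).sub (hxint.mul hxint)
    have hp0 : (p : ℚ) ≠ 0 := by exact_mod_cast hp.ne_zero
    have hAB : (p : ℤ) * (4 * N - A ^ 2) = B ^ 2 := by
      have : (p : ℚ) * (4 * N - A ^ 2) = B ^ 2 := by rw [hA, hB, hN]; ring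
      exact_mod_cast this
    obtain ⟨C, rfl⟩ : (p : ℤ) ∣ B :=
      (Nat.prime_iff_prime_int.1 hp).dvd_of_dvd_pow ⟨_, hAB.symm⟩
    have hC : (C : ℚ) = -2 * v := by
      push_cast at hB
      field_simp at hB
      linarith
    have hAC : 4 * N - A ^ 2 = p * C ^ 2 := by
      have hp0' : (p : ℤ) ≠ 0 := by exact_mod_cast hp.ne_zero
      apply mul_left_cancel₀ hp0'
      rw [hAB]; ring
    have hpar : Even (A + C) := by
      have h1 : A ^ 2 - C ^ 2 = 4 * (N - c * C ^ 2) := by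
        have : (p : ℤ) = 4 * c - 1 := by omega
        rw [this] at hAC
        linear_combination -hAC
      by_contra hodd
      rw [Int.not_even_iff_odd] at hodd
      have h2 : Odd (A - C) := by
        rw [show A - C = A + C - 2 * C by ring]
        exact hodd.sub_even (even_two_mul C)
      have h3 : Odd (A ^ 2 - C ^ 2) := by
        rw [sq_sub_sq]
        exact hodd.mul h2
      rw [h1, ← Int.not_even_iff_odd] at h3
      exact h3 ⟨2 * (N - c * C ^ 2), by ring⟩
    obtain ⟨a, ha⟩ := hpar
    refine ⟨a, -C, ?_⟩
    have hCK : (C : K) = -2 * v := by exact_mod_cast congrArg (Rat.cast : ℚ → K) hC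
    have haK : (A : K) + C = a + a := by exact_mod_cast congrArg (Int.cast : ℤ → K) ha
    refine RingOfIntegers.coe_injective ?_
    simp only [Int.cast_neg, map_add, map_mul, map_neg, map_intCast]
    rw [hω, show algebraMap (𝓞 K) K x = u + v * δ from hx]
    linear_combination (1 / 2 : K) * haK - (1 / 2 : K) * hAK + (δ / 2) * hCK
  · have h : (2 * a + b : K) = -(b * δ) := by
      have := congrArg (algebraMap (𝓞 K) K) hab
      simp only [map_add, map_mul, map_intCast, map_zero] at this
      rw [hω] at this
      linear_combination 2 * this
    have h2 : (2 * a + b) ^ 2 = -(p * b ^ 2) := by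
      have : ((2 * a + b : K)) ^ 2 = -(p * b ^ 2) := by
        rw [h]; linear_combination (b : K) ^ 2 * hδ
      exact_mod_cast this
    have hpp : (0 : ℤ) < p := by exact_mod_cast hp.pos
    have hb : b = 0 := by
      by_contra hb
      have : 0 < b ^ 2 := by positivity
      nlinarith [sq_nonneg (2 * a + b)]
    subst hb
    refine ⟨?_, rfl⟩
    simp at h2
    exact h2

namespace IsQuadraticGenerator

section

variable {R : Type*} [CommRing R] {c : ℕ} {ω : R}

theorem exists_basis (h : IsQuadraticGenerator c ω) :
    ∃ b : Module.Basis (Fin 2) ℤ R, b 0 = 1 ∧ b 1 = ω := by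
  have hli : LinearIndependent ℤ ![(1 : R), ω] := by
    rw [LinearIndependent.pair_iff]
    intro s t hst
    exact h.eq_zero s t (by simpa using hst)
  refine ⟨Module.Basis.mk hli fun x _ => ?_, by simp, by simp⟩
  obtain ⟨a, b, rfl⟩ := h.exists_eq x
  have h0 : (1 : R) ∈ Submodule.span ℤ (Set.range ![(1 : R), ω]) :=
    Submodule.subset_span ⟨0, rfl⟩
  have h1 : ω ∈ Submodule.span ℤ (Set.range ![(1 : R), ω]) :=
    Submodule.subset_span ⟨1, rfl⟩
  have := Submodule.add_mem _ (Submodule.smul_mem _ a h0) (Submodule.smul_mem _ b h1)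
  simpa using this

theorem finrank_int (h : IsQuadraticGenerator c ω) : Module.finrank ℤ R = 2 := by
  obtain ⟨b, -, -⟩ := h.exists_basis
  rw [Module.finrank_eq_card_basis b, Fintype.card_fin]

theorem discr_eq (h : IsQuadraticGenerator c ω) {b : Module.Basis (Fin 2) ℤ R} (h0 : b 0 = 1)
    (h1 : b 1 = ω) : Algebra.discr ℤ b = 1 - 4 * c := by
  have htr1 : Algebra.trace ℤ R 1 = 2 := by
    rw [Algebra.trace_eq_matrix_trace b, map_one, Matrix.trace_one]; rfl
  have htr : Algebra.trace ℤ R ω = 1 := by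
    rw [Algebra.trace_eq_matrix_trace b, Matrix.trace_fin_two, Algebra.leftMulMatrix_eq_repr_mul,
      Algebra.leftMulMatrix_eq_repr_mul, h0, mul_one, ← h1, b.repr_self, h1, h.mul_self,
      show ω - (c : R) = b 1 - (c : ℤ) • b 0 by rw [h0, h1]; simp, map_sub, map_smul, b.repr_self,
      b.repr_self]
    simp
  have htr2 : Algebra.trace ℤ R (ω * ω) = 1 - 2 * c := by
    rw [h.mul_self, map_sub, htr, show (c : R) = (c : ℤ) • (1 : R) by simp, map_smul, htr1]
    simp [mul_comm]
  rw [Algebra.discr_def, Matrix.det_fin_two]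
  simp only [Algebra.traceMatrix_apply, Algebra.traceForm_apply, h0, h1, mul_one, one_mul, htr,
    htr1, htr2]
  ring

theorem eq_one_or_neg_one_of_mul_eq_one (h : IsQuadraticGenerator c ω) (hc : 2 ≤ c) {x y : R}
    (hxy : x * y = 1) : x = 1 ∨ x = -1 := by
  obtain ⟨a, b, rfl⟩ := h.exists_eq x
  obtain ⟨e, f, rfl⟩ := h.exists_eq y
  obtain ⟨hre, him⟩ := h.eq_zero (a * e - c * b * f - 1) (a * f + b * e + b * f) (by
    push_cast
    linear_combination hxy - (b : R) * f * h.mul_self)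
  have hnorm : (a ^ 2 + a * b + c * b ^ 2) * (e ^ 2 + e * f + c * f ^ 2) = 1 := by
    linear_combination (a * e - c * b * f + 1 + (a * f + b * e + b * f)) * hre +
      (1 + c * (a * f + b * e + b * f)) * him
  have hc' : (2 : ℤ) ≤ c := by exact_mod_cast hc
  have hpos : 0 ≤ a ^ 2 + a * b + c * b ^ 2 := by nlinarith [sq_nonneg (2 * a + b), sq_nonneg b]
  have hone : a ^ 2 + a * b + c * b ^ 2 = 1 := Int.eq_one_of_mul_eq_one_right hpos hnorm
  have hb : b = 0 := by
    by_contra hb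
    have : 1 ≤ b ^ 2 := Int.add_one_le_of_lt (by positivity : 0 < b ^ 2)
    nlinarith [sq_nonneg (2 * a + b)]
  subst hb
  have ha : a ^ 2 = 1 := by linarith
  rcases sq_eq_sq_iff_eq_or_eq_neg.1 (ha.trans (one_pow 2).symm) with rfl | rfl <;> simp

end

variable {K : Type*} [Field K] [NumberField K] {c : ℕ} {ω : 𝓞 K}

theorem discr_ringOfIntegers (h : IsQuadraticGenerator c ω) : discr K = 1 - 4 * c := by
  obtain ⟨b, h0, h1⟩ := h.exists_basis
  rw [← discr_eq_discr K b, h.discr_eq h0 h1]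

theorem torsionOrder_eq_two (h : IsQuadraticGenerator c ω) (hc : 2 ≤ c) :
    Units.torsionOrder K = 2 := by
  classical
  let := Fintype.ofFinite (Units.torsion K)
  rw [Units.torsionOrder, Nat.card_eq_fintype_card]
  refine (Finset.card_eq_two.2 ⟨1, ⟨-1, neg_one_mem_torsion⟩,
    by simp [← Subtype.coe_ne_coe], Finset.ext fun x => ⟨fun _ => ?_, fun _ => Finset.mem_univ _⟩⟩)
  rw [Finset.mem_insert, Finset.mem_singleton, ← Subtype.val_inj, ← Subtype.val_inj]
  rcases h.eq_one_or_neg_one_of_mul_eq_one hc (Units.mul_inv x.1) with h | h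
  · exact Or.inl (Units.ext h)
  · exact Or.inr (Units.ext h)

theorem finrank_eq_two (h : IsQuadraticGenerator c ω) : Module.finrank ℚ K = 2 := by
  rw [← RingOfIntegers.rank, h.finrank_int]

theorem nrRealPlaces_eq_zero (h : IsQuadraticGenerator c ω) (hc : 0 < c) :
    InfinitePlace.nrRealPlaces K = 0 := by
  classical
  rw [InfinitePlace.nrRealPlaces, Fintype.card_eq_zero_iff]
  refine ⟨fun ⟨w, hw⟩ => ?_⟩
  have h1 := congrArg (fun x : 𝓞 K => InfinitePlace.embedding_of_isReal hw (x : K)) h.mul_self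
  simp only [map_mul, map_sub, map_natCast] at h1
  have : (1 : ℝ) ≤ c := by exact_mod_cast hc
  nlinarith [sq_nonneg (2 * InfinitePlace.embedding_of_isReal hw (ω : K) - 1)]

theorem nrComplexPlaces_eq_one (h : IsQuadraticGenerator c ω) (hc : 0 < c) :
    InfinitePlace.nrComplexPlaces K = 1 := by
  have := InfinitePlace.card_add_two_mul_card_eq_rank K
  rw [h.nrRealPlaces_eq_zero hc, h.finrank_eq_two] at this
  omega

theorem regulator_eq_one (h : IsQuadraticGenerator c ω) (hc : 0 < c) : Units.regulator K = 1 := by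
  have hcard : Fintype.card (InfinitePlace K) = 1 := by
    rw [InfinitePlace.card_eq_nrRealPlaces_add_nrComplexPlaces, h.nrRealPlaces_eq_zero hc,
      h.nrComplexPlaces_eq_one hc]
  have hrank : Units.rank K = 0 := by rw [Units.rank, hcard]
  have : IsEmpty (Fin (Units.rank K)) := by rw [hrank]; infer_instance
  obtain ⟨w, hw⟩ := Fintype.card_eq_one_iff.1 hcard
  have : IsEmpty {v : InfinitePlace K // v ≠ w} := ⟨fun v => v.2 (hw v.1)⟩
  classical
  rw [Units.regulator_eq_det K w (Equiv.equivOfIsEmpty _ _), Matrix.det_isEmpty, abs_one]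

theorem dedekindZeta_residue_eq (h : IsQuadraticGenerator c ω) (hc : 2 ≤ c) :
    dedekindZeta_residue K = Real.pi * classNumber K / √(4 * c - 1) := by
  have hc' : (2 : ℝ) ≤ c := by exact_mod_cast hc
  rw [dedekindZeta_residue_def, h.nrRealPlaces_eq_zero (by omega),
    h.nrComplexPlaces_eq_one (by omega), h.regulator_eq_one (by omega), h.torsionOrder_eq_two hc,
    h.discr_ringOfIntegers]
  push_cast
  rw [abs_of_nonpos (by linarith), neg_sub]
  field_simp

end IsQuadraticGenerator

namespace Ideal

variable {S : Type*} [CommRing S]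

theorem mul_sup_span_natCast_eq {m n : ℕ} (hmn : m.Coprime n) {I J : Ideal S}
    (hI : (m : S) ∈ I) (hJ : (n : S) ∈ J) : I * J ⊔ span {(m : S)} = I := by
  refine le_antisymm (sup_le mul_le_left (by simpa [span_le] using hI)) fun x hx => ?_
  obtain ⟨u, v, huv⟩ := Nat.isCoprime_iff_coprime.2 hmn
  have huv' : (u : S) * m + v * n = 1 := by exact_mod_cast congrArg (Int.cast : ℤ → S) huv
  have hx' : x = v * (x * n) + u * x * m := by linear_combination -x * huv'
  rw [hx']
  exact Submodule.add_mem _ (mem_sup_left (mul_mem_left _ _ (mul_mem_mul hx hJ)))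
    (mem_sup_right (mul_mem_left _ _ (mem_span_singleton_self _)))

theorem sup_span_natCast_mul_sup_span_natCast {m n : ℕ} (hmn : m.Coprime n) {A : Ideal S}
    (hA : ((m * n : ℕ) : S) ∈ A) : (A ⊔ span {(m : S)}) * (A ⊔ span {(n : S)}) = A := by
  refine le_antisymm ?_ fun x hx => ?_
  · rw [Ideal.sup_mul, Ideal.mul_sup, Ideal.mul_sup, span_singleton_mul_span_singleton]
    refine sup_le (sup_le mul_le_left mul_le_left) (sup_le mul_le_right ?_)
    rw [span_le, Set.singleton_subset_iff]
    exact_mod_cast hA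
  · obtain ⟨u, v, huv⟩ := Nat.isCoprime_iff_coprime.2 hmn
    have huv' : (u : S) * m + v * n = 1 := by exact_mod_cast congrArg (Int.cast : ℤ → S) huv
    have hx' : x = u * (m * x) + v * (x * n) := by linear_combination -x * huv'
    rw [hx']
    exact Submodule.add_mem _
      (mul_mem_left _ _ (mul_mem_mul (mem_sup_right (mem_span_singleton_self _)) (mem_sup_left hx)))
      (mul_mem_left _ _ (mul_mem_mul (mem_sup_left hx) (mem_sup_right (mem_span_singleton_self _))))

variable [IsDedekindDomain S] [Module.Free ℤ S]

theorem dvd_span_natCast_of_absNorm_eq {I : Ideal S} {n : ℕ} (hI : absNorm I = n) :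
    I ∣ span {(n : S)} := by
  rw [dvd_span_singleton, ← hI]
  exact absNorm_mem I

theorem exists_eq_pow_of_absNorm_eq_pow {P I : Ideal S} (hP : Prime P) {q e k : ℕ}
    (hPq : span {(q : S)} = P ^ e) (hI : absNorm I = q ^ k) : ∃ i, I = P ^ i := by
  have h := dvd_span_natCast_of_absNorm_eq hI
  rw [Nat.cast_pow, ← span_singleton_pow, hPq, ← pow_mul, dvd_prime_pow hP] at h
  obtain ⟨i, -, hi⟩ := h
  exact ⟨i, associated_iff_eq.1 hi⟩

theorem card_absNorm_eq_pow_of_ramified {q : ℕ} (hq : q.Prime) {P : Ideal S} (hP : Prime P)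
    (hPq : span {(q : S)} = P ^ 2) (hn : absNorm P = q) (k : ℕ) :
    Nat.card {I : Ideal S // absNorm I = q ^ k} = 1 := by
  rw [Nat.card_eq_one_iff_exists]
  refine ⟨⟨P ^ k, by rw [map_pow, hn]⟩, ?_⟩
  rintro ⟨I, hI⟩
  obtain ⟨i, rfl⟩ := exists_eq_pow_of_absNorm_eq_pow hP hPq hI
  rw [map_pow, hn] at hI
  rw [Subtype.mk.injEq, Nat.pow_right_injective hq.two_le hI]

theorem card_absNorm_eq_pow_of_split {q : ℕ} (hq : q.Prime) {P P' : Ideal S} (hP : Prime P)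
    (hP' : Prime P') (hne : P ≠ P') (hPq : span {(q : S)} = P * P') (hn : absNorm P = q)
    (hn' : absNorm P' = q) (k : ℕ) :
    Nat.card {I : Ideal S // absNorm I = q ^ k} = k + 1 := by
  rw [← Nat.card_fin (k + 1)]
  symm
  refine Nat.card_eq_of_bijective (fun i : Fin (k + 1) => (⟨P ^ (i : ℕ) * P' ^ (k - i), by
    rw [map_mul, map_pow, map_pow, hn, hn', ← pow_add]; congr 1; omega⟩ :
      {I : Ideal S // absNorm I = q ^ k})) ⟨?_, ?_⟩
  · have key : ∀ {i j l m : ℕ}, P ^ i * P' ^ l = P ^ j * P' ^ m → i ≤ j := by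
      intro i j l m h
      have hdvd : P ^ i ∣ P ^ j * P' ^ m := ⟨_, h.symm⟩
      have hcop : IsRelPrime (P ^ i) (P' ^ m) := by
        refine IsRelPrime.pow (hP.irreducible.isRelPrime_iff_not_dvd.2 fun hd => hne ?_)
        exact associated_iff_eq.1 (hP.associated_of_dvd hP' hd)
      have := hcop.dvd_of_dvd_mul_right hdvd
      exact (pow_dvd_pow_iff hP.ne_zero hP.not_isUnit).1 this
    intro i j h
    have h := congrArg Subtype.val h
    exact Fin.ext (le_antisymm (key h) (key h.symm))
  · rintro ⟨I, hI⟩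
    have h := dvd_span_natCast_of_absNorm_eq hI
    rw [Nat.cast_pow, ← span_singleton_pow, hPq, mul_pow] at h
    obtain ⟨A, B, hA, hB, rfl⟩ := exists_dvd_and_dvd_of_dvd_mul h
    obtain ⟨i, -, hi⟩ := (dvd_prime_pow hP _).1 hA
    obtain ⟨j, -, hj⟩ := (dvd_prime_pow hP' _).1 hB
    obtain rfl := associated_iff_eq.1 hi
    obtain rfl := associated_iff_eq.1 hj
    rw [map_mul, map_pow, map_pow, hn, hn', ← pow_add] at hI
    have hij : i + j = k := Nat.pow_right_injective hq.two_le hI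
    exact ⟨⟨i, by omega⟩, Subtype.ext (by simp only [show k - i = j by omega])⟩

variable [Module.Finite ℤ S]

theorem coprime_absNorm_of_natCast_mem {m n : ℕ} (hmn : m.Coprime n) {I : Ideal S}
    (hI : (m : S) ∈ I) : (absNorm I).Coprime n := by
  have h : absNorm I ∣ m ^ Module.finrank ℤ S := by
    rw [← absNorm_span_natCast]
    exact absNorm_dvd_absNorm_of_le (by simpa [span_le] using hI)
  exact Nat.Coprime.coprime_dvd_left h (hmn.pow_left _)

/-- Ideals of norm `m * n`, with `m` and `n` coprime, factor uniquely. -/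
theorem card_absNorm_eq_mul {m n : ℕ} (hmn : m.Coprime n) :
    Nat.card {I : Ideal S // absNorm I = m * n} =
      Nat.card {I : Ideal S // absNorm I = m} * Nat.card {I : Ideal S // absNorm I = n} := by
  rw [← Nat.card_prod]
  symm
  refine Nat.card_eq_of_bijective (fun x : {I : Ideal S // absNorm I = m} ×
    {I : Ideal S // absNorm I = n} => (⟨x.1.1 * x.2.1, by rw [map_mul, x.1.2, x.2.2]⟩ :
      {I : Ideal S // absNorm I = m * n})) ⟨?_, ?_⟩
  · rintro ⟨⟨I, hI⟩, ⟨J, hJ⟩⟩ ⟨⟨I', hI'⟩, ⟨J', hJ'⟩⟩ h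
    have h : I * J = I' * J' := congrArg Subtype.val h
    have mI := hI ▸ absNorm_mem I
    have mJ := hJ ▸ absNorm_mem J
    have mI' := hI' ▸ absNorm_mem I'
    have mJ' := hJ' ▸ absNorm_mem J'
    have e1 : I = I' := by
      rw [← mul_sup_span_natCast_eq hmn mI mJ, h, mul_sup_span_natCast_eq hmn mI' mJ']
    have e2 : J = J' := by
      rw [← mul_sup_span_natCast_eq hmn.symm mJ mI, mul_comm J, h, mul_comm I',
        mul_sup_span_natCast_eq hmn.symm mJ' mI']
    subst e1 e2
    rfl
  · rintro ⟨A, hA⟩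
    have hprod := sup_span_natCast_mul_sup_span_natCast hmn (hA ▸ absNorm_mem A)
    have hnorm : absNorm (A ⊔ span {(m : S)}) * absNorm (A ⊔ span {(n : S)}) = m * n := by
      rw [← map_mul, hprod, hA]
    have c1 := coprime_absNorm_of_natCast_mem hmn (I := A ⊔ span {(m : S)})
      (mem_sup_right (mem_span_singleton_self _))
    have c2 := coprime_absNorm_of_natCast_mem hmn.symm (I := A ⊔ span {(n : S)})
      (mem_sup_right (mem_span_singleton_self _))
    have d1 := c1.dvd_of_dvd_mul_right ⟨_, hnorm.symm⟩
    have d2 := c2.dvd_of_dvd_mul_left (Dvd.intro_left _ hnorm)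
    have d3 : m ∣ absNorm (A ⊔ span {(m : S)}) :=
      c2.symm.dvd_of_dvd_mul_right (hnorm ▸ dvd_mul_right m n)
    have d4 : n ∣ absNorm (A ⊔ span {(n : S)}) :=
      c1.symm.dvd_of_dvd_mul_left (hnorm ▸ dvd_mul_left n m)
    exact ⟨(⟨_, Nat.dvd_antisymm d1 d3⟩, ⟨_, Nat.dvd_antisymm d2 d4⟩), Subtype.ext hprod⟩

theorem card_absNorm_eq_pow_of_inert {q : ℕ} (hq : q.Prime) (hprime : Prime (span {(q : S)}))
    (hrank : Module.finrank ℤ S = 2) (k : ℕ) :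
    Nat.card {I : Ideal S // absNorm I = q ^ k} = if Even k then 1 else 0 := by
  have hn : absNorm (span {(q : S)}) = q ^ 2 := by rw [absNorm_span_natCast, hrank]
  split_ifs with hk
  · obtain ⟨j, rfl⟩ := hk
    rw [Nat.card_eq_one_iff_exists]
    refine ⟨⟨span {(q : S)} ^ j, by rw [map_pow, hn, ← pow_mul, two_mul]⟩, ?_⟩
    rintro ⟨I, hI⟩
    obtain ⟨i, rfl⟩ := exists_eq_pow_of_absNorm_eq_pow hprime (pow_one _).symm hI
    rw [map_pow, hn, ← pow_mul] at hI
    have := Nat.pow_right_injective hq.two_le hI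
    rw [Subtype.mk.injEq, show i = j by omega]
  · rw [Nat.card_eq_zero]
    refine Or.inl ⟨fun ⟨I, hI⟩ => hk ?_⟩
    obtain ⟨i, rfl⟩ := exists_eq_pow_of_absNorm_eq_pow hprime (pow_one _).symm hI
    rw [map_pow, hn, ← pow_mul] at hI
    exact ⟨i, by rw [← Nat.pow_right_injective hq.two_le hI, two_mul]⟩

end Ideal

theorem legendreSym_eq_one_iff_exists_dvd {p q : ℕ} [Fact p.Prime] [Fact q.Prime] (hqp : q ≠ p)
    {c : ℕ} (hc : p + 1 = 4 * c) :
    legendreSym p q = 1 ↔ ∃ r : ℤ, (q : ℤ) ∣ r * r - r + c := by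
  have hp4 : p % 4 = 3 := by omega
  have hp2 : p ≠ 2 := by omega
  by_cases hq2 : q = 2
  · subst hq2
    have h : legendreSym p ((2 : ℕ) : ℤ) = 1 ↔ 2 ∣ c := by
      rw [Nat.cast_two, legendreSym.at_two hp2, ZMod.χ₈_nat_eq_if_mod_eight]
      split_ifs <;> norm_num <;> omega
    rw [h]
    constructor
    · intro h
      exact ⟨0, by simpa using Int.natCast_dvd_natCast.2 h⟩
    · rintro ⟨r, hr⟩
      have hev : (2 : ℤ) ∣ r * r - r := by
        rcases Int.even_or_odd' r with ⟨k, rfl | rfl⟩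
        · exact ⟨2 * k * k - k, by ring⟩
        · exact ⟨2 * k * k + k, by ring⟩
      have := (Int.dvd_add_right hev).1 hr
      exact_mod_cast this
  have hqodd : q % 2 = 1 := (Fact.out : q.Prime).eq_two_or_odd.resolve_left hq2
  have hp0 : ((-(p : ℤ) : ℤ) : ZMod q) ≠ 0 := by
    rw [Int.cast_neg, neg_ne_zero, Int.cast_natCast, Ne, ZMod.natCast_eq_zero_iff]
    exact fun h => hqp ((Nat.prime_dvd_prime_iff_eq Fact.out Fact.out).1 h)
  have hsymb : legendreSym p q = legendreSym q (-(p : ℤ)) := by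
    rw [neg_eq_neg_one_mul, legendreSym.mul, legendreSym.at_neg_one hq2]
    rcases Nat.odd_mod_four_iff.1 hqodd with h | h
    · rw [ZMod.χ₄_nat_one_mod_four h, one_mul,
        legendreSym.quadratic_reciprocity_one_mod_four h hp2]
    · rw [ZMod.χ₄_nat_three_mod_four h, legendreSym.quadratic_reciprocity_three_mod_four h hp4]
      ring
  rw [hsymb, legendreSym.eq_one_iff q hp0]
  have h2 : (2 : ZMod q) ≠ 0 := by
    rw [← Nat.cast_two, Ne, ZMod.natCast_eq_zero_iff]
    exact fun h => hq2 ((Nat.prime_dvd_prime_iff_eq Fact.out Nat.prime_two).1 h)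
  have hc' : (p : ZMod q) + 1 = 4 * c := by exact_mod_cast congrArg (Nat.cast : ℕ → ZMod q) hc
  constructor
  · rintro ⟨y, hy⟩
    obtain ⟨r, hr⟩ := ZMod.intCast_surjective ((y + 1) / 2)
    refine ⟨r, ?_⟩
    rw [← ZMod.intCast_zmod_eq_zero_iff_dvd]
    push_cast at hy ⊢
    rw [hr]
    field_simp
    linear_combination -hy - hc'
  · rintro ⟨r, hr⟩
    rw [← ZMod.intCast_zmod_eq_zero_iff_dvd] at hr
    refine ⟨2 * r - 1, ?_⟩
    push_cast at hr ⊢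
    linear_combination -4 * hr - hc'

namespace IsQuadraticGenerator

variable {R : Type*} [CommRing R] {c : ℕ} {ω : R}

theorem dvd_of_natCast_dvd (h : IsQuadraticGenerator c ω) {n : ℕ} {a b : ℤ}
    (hd : (n : R) ∣ a + b * ω) : (n : ℤ) ∣ a ∧ (n : ℤ) ∣ b := by
  obtain ⟨y, hy⟩ := hd
  obtain ⟨u, v, rfl⟩ := h.exists_eq y
  obtain ⟨h1, h2⟩ := h.eq_zero (a - n * u) (b - n * v) (by push_cast; linear_combination hy)
  exact ⟨⟨u, by linarith⟩, ⟨v, by linarith⟩⟩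

end IsQuadraticGenerator

theorem Ideal.natCast_dvd_of_intCast_mem {R : Type*} [CommRing R] {P : Ideal R} (hP : P ≠ ⊤)
    {q : ℕ} (hq : q.Prime) (hqP : (q : R) ∈ P) {n : ℤ} (hn : (n : R) ∈ P) : (q : ℤ) ∣ n := by
  by_contra hd
  obtain ⟨u, v, huv⟩ := (Nat.prime_iff_prime_int.1 hq).irreducible.coprime_iff_not_dvd.2 hd
  refine hP ((Ideal.eq_top_iff_one P).2 ?_)
  have huv' : (u : R) * q + v * n = 1 := by exact_mod_cast congrArg (Int.cast : ℤ → R) huv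
  rw [← huv']
  exact P.add_mem (P.mul_mem_left _ hqP) (P.mul_mem_left _ hn)

namespace IsQuadraticGenerator

variable {R : Type*} [CommRing R] [IsDedekindDomain R] [Module.Free ℤ R] [Module.Finite ℤ R]
  {c : ℕ} {ω : R}

open Ideal

theorem exists_eq_mul_prime (h : IsQuadraticGenerator c ω) {q : ℕ} (hq : q.Prime) {r : ℤ}
    (hr : (q : ℤ) ∣ r * r - r + c) (hr2 : ¬ (q : ℤ) ∣ 2 * r - 1) :
    ∃ P P' : Ideal R, Prime P ∧ Prime P' ∧ P ≠ P' ∧ span {(q : R)} = P * P' ∧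
      absNorm P = q ∧ absNorm P' = q := by
  obtain ⟨t, ht⟩ := hr
  have ht' : (r : R) * r - r + c = q * t := by exact_mod_cast congrArg (Int.cast : ℤ → R) ht
  obtain ⟨u, v, huv⟩ := (Nat.prime_iff_prime_int.1 hq).irreducible.coprime_iff_not_dvd.2 hr2
  have huv' : (u : R) * q + v * (2 * r - 1) = 1 := by
    exact_mod_cast congrArg (Int.cast : ℤ → R) huv
  have hω := h.mul_self
  set P : Ideal R := span {(q : R), r - ω} with hP
  set P' : Ideal R := span {(q : R), r - 1 + ω} with hP'
  have q1 : (q : R) ∈ P := subset_span (by simp)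
  have q2 : (q : R) ∈ P' := subset_span (by simp)
  have r1 : (r : R) - ω ∈ P := subset_span (by simp)
  have r2 : (r : R) - 1 + ω ∈ P' := subset_span (by simp)
  have hmul : span {(q : R)} = P * P' := by
    refine le_antisymm ?_ ?_
    · rw [span_le, Set.singleton_subset_iff, SetLike.mem_coe,
        show (q : R) = u * (q * q) + v * ((r - ω) * q + q * (r - 1 + ω)) by
          linear_combination -q * huv']
      exact add_mem (mul_mem_left _ _ (mul_mem_mul q1 q2)) (mul_mem_left _ _
        (add_mem (mul_mem_mul r1 q2) (mul_mem_mul q1 r2)))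
    · rw [hP, hP', span_pair_mul_span_pair, span_le]
      rintro x (rfl | rfl | rfl | rfl) <;> rw [SetLike.mem_coe, mem_span_singleton]
      · exact dvd_mul_right _ _
      · exact dvd_mul_right _ _
      · exact dvd_mul_left _ _
      · exact ⟨t, by linear_combination ht' - hω⟩
  have hnorm : absNorm P * absNorm P' = q ^ 2 := by
    rw [← map_mul, ← hmul, absNorm_span_natCast, h.finrank_int]
  have hnP : absNorm P ≠ 1 := by
    intro h1
    rw [absNorm_eq_one_iff] at h1
    rw [h1, top_mul] at hmul
    rw [← hmul, mem_span_singleton] at r2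
    have := h.dvd_of_natCast_dvd (n := q) (a := r - 1) (b := 1) (by push_cast; simpa using r2)
    exact hq.one_lt.ne' (by exact_mod_cast Int.eq_one_of_dvd_one (by positivity) this.2)
  have hnP' : absNorm P' ≠ 1 := by
    intro h1
    rw [absNorm_eq_one_iff] at h1
    rw [h1, mul_top] at hmul
    rw [← hmul, mem_span_singleton] at r1
    have := h.dvd_of_natCast_dvd (n := q) (a := r) (b := -1)
      (by push_cast; simpa [sub_eq_add_neg] using r1)
    have h1 : (q : ℤ) ∣ 1 := by simpa using this.2
    exact hq.one_lt.ne' (by exact_mod_cast Int.eq_one_of_dvd_one (by positivity) h1)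
  obtain ⟨n1, n2⟩ := (Nat.Prime.mul_eq_prime_sq_iff hq hnP hnP').1 hnorm
  have prime_of : ∀ Q : Ideal R, absNorm Q = q → Prime Q := fun Q hQ => by
    have : Q.IsPrime := isPrime_of_irreducible_absNorm (by rw [hQ]; exact hq)
    refine prime_of_isPrime ?_ this
    rintro rfl
    rw [← Ideal.zero_eq_bot, map_zero] at hQ
    exact hq.ne_zero hQ.symm
  refine ⟨P, P', prime_of P n1, prime_of P' n2, fun he => ?_, hmul, n1, n2⟩
  rw [← he] at r2
  refine hnP (absNorm_eq_one_iff.2 ((eq_top_iff_one _).2 ?_))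
  rw [← huv', show (2 : R) * r - 1 = (r - ω) + (r - 1 + ω) by ring]
  exact add_mem (mul_mem_left _ _ q1) (mul_mem_left _ _ (add_mem r1 r2))

theorem prime_span_natCast (h : IsQuadraticGenerator c ω) {q : ℕ} (hq : q.Prime)
    (hr : ¬ ∃ r : ℤ, (q : ℤ) ∣ r * r - r + c) : Prime (span {(q : R)}) := by
  have hnq : absNorm (span {(q : R)}) = q ^ 2 := by rw [absNorm_span_natCast, h.finrank_int]
  have hne : span {(q : R)} ≠ ⊤ := fun h1 => by
    rw [← absNorm_eq_one_iff, hnq] at h1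
    exact hq.one_lt.ne' (by simpa using h1)
  obtain ⟨P, hP, hle⟩ := exists_le_maximal _ hne
  have hqP : (q : R) ∈ P := hle (mem_span_singleton_self _)
  have hd := absNorm_dvd_absNorm_of_le hle
  rw [hnq, Nat.dvd_prime_pow hq] at hd
  obtain ⟨k, hk, hnP⟩ := hd
  have hq0 : span {(q : R)} ≠ ⊥ := fun h1 => by
    rw [h1, ← Ideal.zero_eq_bot, map_zero] at hnq
    exact pow_ne_zero 2 hq.ne_zero hnq.symm
  obtain rfl | rfl | rfl : k = 0 ∨ k = 1 ∨ k = 2 := by omega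
  · rw [pow_zero, absNorm_eq_one_iff] at hnP
    exact absurd hnP hP.ne_top
  · exfalso
    have : Fact q.Prime := ⟨hq⟩
    rw [pow_one] at hnP
    have hcard : Nat.card (R ⧸ P) = q := by rw [← hnP]; rfl
    have : Finite (R ⧸ P) := Nat.finite_of_card_ne_zero (hcard ▸ hq.ne_zero)
    have : Fintype (R ⧸ P) := Fintype.ofFinite _
    let e := ZMod.ringEquivOfPrime (R ⧸ P) hq (by rw [← hcard, Nat.card_eq_fintype_card])
    obtain ⟨r, hr'⟩ := ZMod.intCast_surjective (e.symm (Ideal.Quotient.mk P ω))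
    have hrω : Ideal.Quotient.mk P (r - ω) = 0 := by
      rw [map_sub, map_intCast, ← e.apply_symm_apply (Ideal.Quotient.mk P ω), ← hr', map_intCast,
        sub_self]
    rw [Ideal.Quotient.eq_zero_iff_mem] at hrω
    refine hr ⟨r, natCast_dvd_of_intCast_mem hP.ne_top hq hqP ?_⟩
    push_cast
    rw [show (r : R) * r - r + c = (r - 1 + ω) * (r - ω) by linear_combination h.mul_self]
    exact mul_mem_left _ _ hrω
  · obtain ⟨J, hJ⟩ := dvd_iff_le.2 hle
    have h1 : absNorm J = 1 := by
      have := congrArg absNorm hJ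
      rw [map_mul, hnq, hnP] at this
      exact (Nat.mul_eq_left (pow_ne_zero 2 hq.ne_zero)).1 this.symm
    rw [absNorm_eq_one_iff] at h1
    rw [h1, mul_top] at hJ
    rw [hJ] at hq0 ⊢
    exact prime_of_isPrime hq0 hP.isPrime

theorem exists_eq_sq_prime (h : IsQuadraticGenerator c ω) {p : ℕ} (hp : p.Prime)
    (hc : p + 1 = 4 * c) : ∃ P : Ideal R, Prime P ∧ span {(p : R)} = P ^ 2 ∧ absNorm P = p := by
  have hc' : (p : R) + 1 = 4 * c := by exact_mod_cast congrArg (Nat.cast : ℕ → R) hc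
  have hsq : span {(p : R)} = span {2 * ω - 1} ^ 2 := by
    rw [span_singleton_pow, show (2 * ω - 1) ^ 2 = -(p : R) by
      linear_combination 4 * h.mul_self + hc', span_singleton_neg]
  have hn : absNorm (span {2 * ω - 1}) = p := by
    have := congrArg absNorm hsq
    rw [map_pow, absNorm_span_natCast, h.finrank_int] at this
    exact (Nat.pow_left_injective two_ne_zero this).symm
  refine ⟨_, prime_of_isPrime ?_ (isPrime_of_irreducible_absNorm (by rw [hn]; exact hp)), hsq, hn⟩
  intro h1
  rw [h1, ← Ideal.zero_eq_bot, map_zero] at hn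
  exact hp.ne_zero hn.symm

theorem card_absNorm_eq_prime_pow (h : IsQuadraticGenerator c ω) {p : ℕ} [Fact p.Prime]
    (hc : p + 1 = 4 * c) {q : ℕ} (hq : q.Prime) (k : ℕ) :
    (Nat.card {I : Ideal R // Ideal.absNorm I = q ^ k} : ℤ) =
      ∑ i ∈ Finset.range (k + 1), legendreSym p q ^ i := by
  have hp : p.Prime := Fact.out
  have : Fact q.Prime := ⟨hq⟩
  by_cases hqp : q = p
  · subst hqp
    obtain ⟨P, hP, hsq, hn⟩ := h.exists_eq_sq_prime hq hc
    rw [Ideal.card_absNorm_eq_pow_of_ramified hq hP hsq hn,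
      (legendreSym.eq_zero_iff q q).2 (by simp), Finset.sum_range_succ']
    simp
  have hiff := legendreSym_eq_one_iff_exists_dvd hqp hc
  have hq0 : ((q : ℤ) : ZMod p) ≠ 0 := by
    rw [Int.cast_natCast, Ne, ZMod.natCast_eq_zero_iff]
    exact fun hd => hqp ((Nat.prime_dvd_prime_iff_eq hp hq).1 hd).symm
  rcases legendreSym.eq_one_or_neg_one p hq0 with h1 | h1
  · obtain ⟨r, hr⟩ := hiff.1 h1
    have hr2 : ¬ (q : ℤ) ∣ 2 * r - 1 := fun hd => by
      have hqd : (q : ℤ) ∣ p := by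
        have := (Dvd.dvd.mul_left hr 4).sub (hd.mul_left (2 * r - 1))
        have hc' : (p : ℤ) + 1 = 4 * c := by exact_mod_cast hc
        rwa [show 4 * (r * r - r + c) - (2 * r - 1) * (2 * r - 1) = (p : ℤ) by
          linear_combination -hc'] at this
      exact hqp ((Nat.prime_dvd_prime_iff_eq hq hp).1 (by exact_mod_cast hqd))
    obtain ⟨P, P', hP, hP', hne, hmul, hn, hn'⟩ := h.exists_eq_mul_prime hq hr hr2
    rw [Ideal.card_absNorm_eq_pow_of_split hq hP hP' hne hmul hn hn', h1]
    simp
  · have hr : ¬ ∃ r : ℤ, (q : ℤ) ∣ r * r - r + c := by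
      rw [← hiff, h1]
      decide
    rw [Ideal.card_absNorm_eq_pow_of_inert hq (h.prime_span_natCast hq hr) h.finrank_int, h1,
      neg_one_geom_sum]
    simp only [Nat.even_add_one]
    split_ifs <;> simp_all

theorem card_absNorm_eq_sum_divisors (h : IsQuadraticGenerator c ω) {p : ℕ} [Fact p.Prime]
    (hc : p + 1 = 4 * c) {n : ℕ} (hn : n ≠ 0) :
    (Nat.card {I : Ideal R // Ideal.absNorm I = n} : ℤ) =
      ∑ d ∈ n.divisors, legendreSym p d := by
  let χ : ArithmeticFunction ℤ := ⟨fun n => legendreSym p n, by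
    simp [(legendreSym.eq_zero_iff p 0).2]⟩
  have hχ : χ.IsMultiplicative :=
    ⟨legendreSym.at_one p, fun {m n} _ => by
      change legendreSym p ((m * n : ℕ) : ℤ) = legendreSym p m * legendreSym p n
      rw [Nat.cast_mul, legendreSym.mul]⟩
  have hχζ := hχ.mul (ArithmeticFunction.isMultiplicative_zeta.natCast (R := ℤ))
  have hsum : ∀ n : ℕ, ∑ d ∈ n.divisors, legendreSym p d =
      (χ * (ArithmeticFunction.zeta : ArithmeticFunction ℤ)) n := fun n =>
    (ArithmeticFunction.coe_mul_zeta_apply (f := χ) (x := n)).symm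
  induction n using Nat.recOnPosPrimePosCoprime with
  | zero => exact absurd rfl hn
  | one => simp
  | prime_pow q k hq _ =>
    rw [h.card_absNorm_eq_prime_pow hc hq, Nat.sum_divisors_prime_pow hq]
    refine Finset.sum_congr rfl fun i _ => ?_
    rw [Nat.cast_pow]
    exact (map_pow (legendreSym.hom p) (q : ℤ) i).symm
  | coprime a b ha hb hab iha ihb =>
    rw [Ideal.card_absNorm_eq_mul hab, Nat.cast_mul, iha (by omega), ihb (by omega), hsum, hsum,
      hsum, hχζ.map_mul_of_coprime hab]

end IsQuadraticGenerator

theorem LSeries_legendreSym_eq_tsum (p : ℕ) [Fact p.Prime] {s : ℝ} (hs : 1 < s) :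
    LSeriesSummable (fun n => (legendreSym p n : ℂ)) s ∧
      LSeries (fun n => (legendreSym p n : ℂ)) s =
        ((∑' n : ℕ, (legendreSym p n : ℝ) * (n : ℝ) ^ (-s) : ℝ) : ℂ) := by
  have hterm : LSeries.term (fun n => (legendreSym p n : ℂ)) s =
      fun n : ℕ => (((legendreSym p n : ℝ) * (n : ℝ) ^ (-s) : ℝ) : ℂ) := by
    ext n
    rw [LSeries.term_def₀ (by simp [(legendreSym.eq_zero_iff p 0).2]), Complex.ofReal_mul,
      Complex.ofReal_cpow (Nat.cast_nonneg n)]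
    push_cast
    rfl
  rw [LSeriesSummable, LSeries, hterm, Complex.ofReal_tsum]
  exact ⟨Complex.summable_ofReal.2 (summable_legendreSym_mul_rpow_neg p hs), rfl⟩

namespace IsQuadraticGenerator

variable {K : Type*} [Field K] [NumberField K] {c : ℕ} {ω : 𝓞 K}

theorem dedekindZeta_eq_mul (h : IsQuadraticGenerator c ω) {p : ℕ} [Fact p.Prime]
    (hc : p + 1 = 4 * c) {s : ℝ} (hs : 1 < s) :
    dedekindZeta K s = riemannZeta s *
      ((∑' n : ℕ, (legendreSym p n : ℝ) * (n : ℝ) ^ (-s) : ℝ) : ℂ) := by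
  have hs' : 1 < (s : ℂ).re := by simpa using hs
  obtain ⟨hsum, heq⟩ := LSeries_legendreSym_eq_tsum p hs
  rw [← heq, ← LSeries_one_eq_riemannZeta hs',
    ← LSeries_convolution' (LSeriesSummable_one_iff.2 hs') hsum, dedekindZeta]
  refine LSeries_congr (fun {n} hn => ?_) _
  rw [LSeries.convolution_def, ← Int.cast_natCast, h.card_absNorm_eq_sum_divisors hc hn,
    Int.cast_sum, ← Nat.sum_divisorsAntidiagonal' (f := fun _ d => (legendreSym p (d : ℕ) : ℂ))]
  simp

/-- Dirichlet's class number formula for `ℚ(√-p)`. -/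
theorem natCast_mul_classNumber (h : IsQuadraticGenerator c ω) {p : ℕ} [Fact p.Prime]
    (hc : p + 1 = 4 * c) (hc2 : 2 ≤ c) :
    (p : ℤ) * classNumber K = -∑ a ∈ Finset.range p, (a : ℤ) * legendreSym p a := by
  have hp : 0 < (p : ℝ) := by exact_mod_cast (Fact.out : p.Prime).pos
  have hζ : Tendsto (fun s : ℝ => ((s : ℂ) - 1) * riemannZeta s) (𝓝[>] 1) (𝓝 1) := by
    refine riemannZeta_residue_one.comp (tendsto_nhdsWithin_iff.2 ⟨?_, ?_⟩)
    · exact (Complex.continuous_ofReal.tendsto' 1 1 Complex.ofReal_one).mono_left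
        nhdsWithin_le_nhds
    · filter_upwards [self_mem_nhdsWithin] with s hs
      simpa using (ne_of_gt hs : s ≠ 1)
  have hL := (Complex.continuous_ofReal.tendsto _).comp
    (tendsto_tsum_legendreSym p (by omega))
  have hres := tendsto_nhds_unique (tendsto_sub_one_mul_dedekindZeta_nhdsGT K)
    ((hζ.mul hL).congr' (by
      filter_upwards [self_mem_nhdsWithin] with s hs
      rw [h.dedekindZeta_eq_mul hc hs, Function.comp_apply, mul_assoc]))
  have hc' : (p : ℝ) + 1 = 4 * c := by exact_mod_cast hc
  rw [one_mul, Complex.ofReal_inj, h.dedekindZeta_residue_eq hc2,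
    show (4 * c - 1 : ℝ) = p by linarith] at hres
  have hpi := Real.pi_pos
  have hsqrt := Real.sqrt_pos.2 hp
  have hreal : (p : ℝ) * classNumber K = -∑ a ∈ Finset.range p, (a : ℝ) * legendreSym p a := by
    field_simp at hres
    linarith
  exact_mod_cast hreal

end IsQuadraticGenerator

theorem bernoulli_class_number_congruence (p : ℕ) (hp : p.Prime) (hp3 : 3 < p)
    (hp4 : p % 4 = 3) (K : Type*) [Field K] [NumberField K]
    (hrank : Module.finrank ℚ K = 2) (hsqrt : ∃ α : K, α ^ 2 = -(p : K)) :
    0 ≤ padicValRat p (bernoulli ((p + 1) / 2)) ∧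
      1 ≤ padicValRat p
          (bernoulli ((p + 1) / 2) + (1 / 2) * (NumberField.classNumber K : ℚ)) ∧
      ¬ 1 ≤ padicValRat p (bernoulli ((p + 1) / 2)) := by
  have : Fact p.Prime := ⟨hp⟩
  obtain ⟨ω, hω⟩ := exists_isQuadraticGenerator hrank hp hp4 hsqrt
  have hformula := hω.natCast_mul_classNumber (p := p) (by omega) (by omega)
  have hp0 : (p : ℤ) ≠ 0 := by exact_mod_cast hp.ne_zero
  have hlt := neg_sum_range_mul_legendreSym_lt p
  rw [← hformula] at hlt
  refine bernoulli_congruence_of_class_number_formula p hp3 hp4 (classNumber K)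
    (classNumber_pos K) ?_ ?_
  · exact_mod_cast lt_of_mul_lt_mul_left hlt (Int.natCast_nonneg p)
  · refine mul_left_cancel₀ hp0 ?_
    linear_combination (2 - legendreSym p 2) * hformula +
      legendreSym_two_sub_two_mul_sum p (by omega)
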